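/- Let (u, p) be a weak solution of the HHMO model. Then liminf_{x→∞} u(x, x²/α²) ≤ u*, and for every Y > 0 the essential infimum of p over the set {(x,t) : x ≥ Y, t ≥ x²/α²} is strictly less than 1; in particular, there is no precipitation ring of infinite width. -/

import Mathlib

open MeasureTheory Filter Set

noncomputable section

/-- The precipitation-free self-similar solution `ψ(x,t)`. -/
def psi (α β x t : ℝ) : ℝ :=
  if 0 < t then
    (α * β / 2) * Real.exp (α ^ 2 / 4) *
      ∫ ζ in Set.Ioi (max (|x| / Real.sqrt t) α), Real.exp (-ζ ^ 2 / 4)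
  else 0

/-- The profile `Ψ(η)` in similarity coordinates. -/
def PsiP (α β η : ℝ) : ℝ :=
  (α * β / 2) * Real.exp (α ^ 2 / 4) * ∫ ζ in Set.Ioi (max η α), Real.exp (-ζ ^ 2 / 4)

/-- Regularity of a weak solution: `w` is the spatial derivative of `u - ψ`;
both are continuous on `ℝ × [0,∞)` and bounded on `ℝ × [0,T]` for every `T > 0`. -/
def AuxReg (α β : ℝ) (u w : ℝ → ℝ → ℝ) : Prop :=
  (∀ t ∈ Set.Ici (0:ℝ), ∀ x : ℝ, HasDerivAt (fun y => u y t - psi α β y t) (w x t) x) ∧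
  ContinuousOn (fun q : ℝ × ℝ => u q.1 q.2 - psi α β q.1 q.2) (Set.univ ×ˢ Set.Ici 0) ∧
  ContinuousOn (fun q : ℝ × ℝ => w q.1 q.2) (Set.univ ×ˢ Set.Ici 0) ∧
  ∀ T > (0:ℝ), ∃ C : ℝ, ∀ x : ℝ, ∀ t ∈ Set.Icc (0:ℝ) T,
    |u x t - psi α β x t| ≤ C ∧ |w x t| ≤ C

/-- A test function of class `C^{1,1}(ℝ × [0,T])`, vanishing for large `|x|` and at `t = T`,
together with its partial derivatives `φt`, `φx`. -/
def IsTestFun (T : ℝ) (φ φt φx : ℝ → ℝ → ℝ) : Prop :=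
  (∀ x : ℝ, ∀ t ∈ Set.Icc (0:ℝ) T,
    HasDerivWithinAt (fun s => φ x s) (φt x t) (Set.Icc 0 T) t) ∧
  (∀ x : ℝ, ∀ t ∈ Set.Icc (0:ℝ) T, HasDerivAt (fun y => φ y t) (φx x t) x) ∧
  ContinuousOn (fun q : ℝ × ℝ => φ q.1 q.2) (Set.univ ×ˢ Set.Icc 0 T) ∧
  ContinuousOn (fun q : ℝ × ℝ => φt q.1 q.2) (Set.univ ×ˢ Set.Icc 0 T) ∧
  ContinuousOn (fun q : ℝ × ℝ => φx q.1 q.2) (Set.univ ×ˢ Set.Icc 0 T) ∧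
  (∃ R : ℝ, ∀ x : ℝ, ∀ t ∈ Set.Icc (0:ℝ) T, R ≤ |x| → φ x t = 0) ∧
  (∀ x : ℝ, φ x T = 0)

/-- The weak form of the equation, relative to a given precipitation function `p` and
the spatial derivative `w` of `u - ψ`. -/
def WeakForm (α β : ℝ) (u p w : ℝ → ℝ → ℝ) : Prop :=
  ∀ T > (0:ℝ), ∀ φ φt φx : ℝ → ℝ → ℝ, IsTestFun T φ φt φx →
    (∫ t in Set.Ioc (0:ℝ) T, ∫ x : ℝ, φt x t * (u x t - psi α β x t))
      = ∫ t in Set.Ioc (0:ℝ) T, ∫ x : ℝ, (φx x t * w x t + p x t * u x t * φ x t)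

/-- A weak solution of the linear auxiliary problem with given precipitation function `p`. -/
def IsAuxSolution (α β : ℝ) (p u : ℝ → ℝ → ℝ) : Prop :=
  (∀ x t : ℝ, u (-x) t = u x t) ∧
  ∃ w : ℝ → ℝ → ℝ, AuxReg α β u w ∧ WeakForm α β u p w

/-- A weak solution `(u, p)` of the HHMO model. -/
def IsWeakSolution (α β ustar : ℝ) (u p : ℝ → ℝ → ℝ) : Prop :=
  (∀ x t : ℝ, u (-x) t = u x t) ∧
  (∀ x t : ℝ, p (-x) t = p x t) ∧
  Measurable (fun q : ℝ × ℝ => p q.1 q.2) ∧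
  (∀ x : ℝ, ∀ t ∈ Set.Ici (0:ℝ),
    (sSup ((fun s => u x s) '' Set.Icc 0 t) < ustar → p x t = 0) ∧
    (sSup ((fun s => u x s) '' Set.Icc 0 t) = ustar → p x t ∈ Set.Icc (0:ℝ) 1) ∧
    (ustar < sSup ((fun s => u x s) '' Set.Icc 0 t) → p x t = 1)) ∧
  (∀ x : ℝ, MonotoneOn (fun t => p x t) (Set.Ici (0:ℝ))) ∧
  ∃ w : ℝ → ℝ → ℝ, AuxReg α β u w ∧ WeakForm α β u p w

/-- Condition (P): the precipitation function depends only on `x` beyond the parabola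
`t = x²/α²`. -/
def CondP (α : ℝ) (p : ℝ → ℝ → ℝ) (pstar : ℝ → ℝ) : Prop :=
  Measurable pstar ∧
  ∀ᵐ x ∂(volume.restrict (Set.Ioi (0:ℝ))), ∀ t : ℝ, x ^ 2 / α ^ 2 < t → p x t = pstar x

/-- The admissible class `𝒜` of precipitation functions. -/
def IsAdmissible (p : ℝ → ℝ → ℝ) : Prop :=
  (∀ x t : ℝ, p (-x) t = p x t) ∧
  MeasureTheory.LocallyIntegrableOn (fun q : ℝ × ℝ => p q.1 q.2) (Set.Ioi 0 ×ˢ Set.Ici 0) ∧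
  ∀ T > (0:ℝ), ∃ R : ℝ, ∀ x ≥ R, ∀ t ∈ Set.Icc (0:ℝ) T, p x t = 0

/-- `u` converges uniformly, in parabolic similarity coordinates, to the profile `Φ`. -/
def ConvUnif (u : ℝ → ℝ → ℝ) (Φ : ℝ → ℝ) : Prop :=
  ∀ ε > (0:ℝ), ∃ T : ℝ, ∀ t ≥ T, ∀ η ≥ (0:ℝ), |u (η * Real.sqrt t) t - Φ η| < ε

/-- The error function. -/
def erf (x : ℝ) : ℝ := (2 / Real.sqrt Real.pi) * ∫ s in (0:ℝ)..x, Real.exp (-s ^ 2)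

/-- The complementary error function. -/
def erfc (x : ℝ) : ℝ := (2 / Real.sqrt Real.pi) * ∫ s in Set.Ioi x, Real.exp (-s ^ 2)

/-- Kummer's confluent hypergeometric function `M(a,b,z)` (real arguments). -/
def kummerM (a b z : ℝ) : ℝ :=
  ∑' n : ℕ, (Polynomial.eval a (ascPochhammer ℝ n) / Polynomial.eval b (ascPochhammer ℝ n))
    * z ^ n / (n.factorial : ℝ)

/-- `κ = (1 + √(4γ+1))/2`, the positive root of `κ(κ-1) = γ`. -/
def kappaOf (γ : ℝ) : ℝ := (1 + Real.sqrt (4 * γ + 1)) / 2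

/-- The value `u*_γ` determined by the derivative matching condition. -/
def ustarGamma (α β γ : ℝ) : ℝ :=
  (α * β / 2) *
    (kappaOf γ * kummerM (kappaOf γ / 2 + 1) (kappaOf γ + 1 / 2) (-α ^ 2 / 4) /
        (α * kummerM (kappaOf γ / 2) (kappaOf γ + 1 / 2) (-α ^ 2 / 4)) +
      Real.exp (-α ^ 2 / 4) / (Real.sqrt Real.pi * erfc (α / 2)))⁻¹

/-- The self-similar profile `Φ_γ`. -/
def Phi (α β γ η : ℝ) : ℝ :=
  if η < α then
    ustarGamma α β γ * η ^ kappaOf γ *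
      kummerM (kappaOf γ / 2) (kappaOf γ + 1 / 2) (-η ^ 2 / 4) /
      (α ^ kappaOf γ * kummerM (kappaOf γ / 2) (kappaOf γ + 1 / 2) (-α ^ 2 / 4))
  else ustarGamma α β γ * erfc (η / 2) / erfc (α / 2)

/-- If `a' = -b` weakly on `[0, T]`, including the initial condition `a 0 = 0`, then
`a T = -∫ b`. -/
lemma eq_neg_integral_of_weak {a b : ℝ → ℝ} {T : ℝ} (hT : 0 < T) (ha : Continuous a)
    (hb : ∀ t, IntervalIntegrable b volume 0 t)
    (h : ∀ θ θ' : ℝ → ℝ, Continuous θ' → (∀ t, HasDerivAt θ (θ' t) t) → θ T = 0 →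
      ∫ t in (0:ℝ)..T, θ' t * a t = ∫ t in (0:ℝ)..T, θ t * b t) :
    a T = -∫ t in (0:ℝ)..T, b t := by
  have hb' : ∀ s t, IntervalIntegrable b volume s t := fun s t => (hb s).symm.trans (hb t)
  set B : ℝ → ℝ := fun t => ∫ s in (0:ℝ)..t, b s with hB
  have hBc : Continuous B := intervalIntegral.continuous_primitive hb' 0
  set g : ℝ → ℝ := fun t => a t + B t with hg
  have hgc : Continuous g := ha.add hBc
  set θ : ℝ → ℝ := fun t => ∫ s in T..t, g s with hθ
  have hθd : ∀ t, HasDerivAt θ (g t) t := fun t => hgc.integral_hasStrictDerivAt T t |>.hasDerivAt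
  have hθac : AbsolutelyContinuousOnInterval θ 0 T := by
    have : ContDiff ℝ 1 θ := by
      rw [contDiff_one_iff_deriv]
      refine ⟨fun t => (hθd t).differentiableAt, ?_⟩
      rw [show deriv θ = g from funext fun t => (hθd t).deriv]
      exact hgc
    exact this.contDiffOn.absolutelyContinuousOnInterval
  have hBac : AbsolutelyContinuousOnInterval B 0 T :=
    (hb T).absolutelyContinuousOnInterval_intervalIntegral (by simp)
  have hparts := hθac.integral_mul_deriv_eq_deriv_mul hBac
  have hBd : ∫ t in (0:ℝ)..T, θ t * deriv B t = ∫ t in (0:ℝ)..T, θ t * b t := by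
    refine intervalIntegral.integral_congr_ae ?_
    filter_upwards [(hb T).ae_hasDerivAt_integral] with t ht htm
    rw [(ht (uIoc_subset_uIcc htm) 0 (by simp)).deriv]
  have hw := h θ g hgc hθd (by simp [hθ])
  have hθ' : deriv θ = g := funext fun t => (hθd t).deriv
  have hB0 : B 0 = 0 := by simp [hB]
  have hθT : θ T = 0 := by simp [hθ]
  rw [hBd, ← hw, hB0, hθT, hθ'] at hparts
  have hsq : ∫ t in (0:ℝ)..T, g t * g t = 0 := by
    have hsplit : ∀ t, g t * g t = g t * a t + g t * B t := fun t => by simp only [hg]; ring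
    have hga : Continuous fun t => g t * a t := hgc.mul ha
    have hgB : Continuous fun t => g t * B t := hgc.mul hBc
    simp_rw [hsplit]
    rw [intervalIntegral.integral_add (hga.intervalIntegrable _ _)
      (hgB.intervalIntegrable _ _), hparts]
    ring
  by_contra hne
  have hgT : g T ≠ 0 := fun h0 => hne (by simp only [hg, hB] at h0; linarith)
  have : 0 < ∫ t in (0:ℝ)..T, g t * g t :=
    intervalIntegral.integral_pos hT (hgc.mul hgc).continuousOn
      (fun t _ => mul_self_nonneg _) ⟨T, by simp [hT.le], mul_self_pos.2 hgT⟩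
  linarith

lemma intervalIntegrable_integral_test {w g : ℝ → ℝ → ℝ}
    (hw : Continuous fun q : ℝ × ℝ => w q.1 q.2)
    (hgm : Measurable fun q : ℝ × ℝ => g q.1 q.2)
    (hgb : ∀ T : ℝ, ∃ C : ℝ, ∀ x : ℝ, ∀ t ≤ T, |g x t| ≤ C)
    {φ φ' : ℝ → ℝ} (hφ : Continuous φ) (hφ' : Continuous φ') {R : ℝ}
    (hR : ∀ x, R ≤ |x| → φ x = 0) (hR' : ∀ x, R ≤ |x| → φ' x = 0) (s t : ℝ) :
    IntervalIntegrable (fun t => ∫ x, (φ' x * w x t + g x t * φ x)) volume s t := by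
  wlog hst : s ≤ t generalizing s t
  · exact (this t s (not_le.1 hst).le).symm
  rw [intervalIntegrable_iff_integrableOn_Icc_of_le hst]
  set F : ℝ × ℝ → ℝ := fun q => φ' q.2 * w q.2 q.1 + g q.2 q.1 * φ q.2 with hF
  have hFm : Measurable F := by
    have h1 : Measurable fun q : ℝ × ℝ => w q.2 q.1 := hw.measurable.comp measurable_swap
    have h2 : Measurable fun q : ℝ × ℝ => g q.2 q.1 := hgm.comp measurable_swap
    exact ((hφ'.measurable.comp measurable_snd).mul h1).add
      (h2.mul (hφ.measurable.comp measurable_snd))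
  have hbound : ∃ C, ∀ q ∈ Icc s t ×ˢ Icc (-R) R, ‖F q‖ ≤ C := by
    obtain ⟨C, hC⟩ := hgb t
    have hcont : Continuous fun q : ℝ × ℝ => |φ' q.2 * w q.2 q.1| + C * |φ q.2| := by
      have h1 : Continuous fun q : ℝ × ℝ => w q.2 q.1 := hw.comp continuous_swap
      fun_prop
    obtain ⟨M, hM⟩ := ((isCompact_Icc (a := s) (b := t)).prod
      (isCompact_Icc (a := -R) (b := R))).bddAbove_image hcont.continuousOn
    refine ⟨M, fun q hq => (le_trans ?_ (hM ⟨q, hq, rfl⟩))⟩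
    simp only [hF, Real.norm_eq_abs]
    refine (abs_add_le _ _).trans ?_
    rw [abs_mul (g q.2 q.1)]
    gcongr
    exact hC _ _ hq.1.2
  obtain ⟨C, hC⟩ := hbound
  have hint : IntegrableOn F (Icc s t ×ˢ Icc (-R) R) (volume.prod volume) := by
    refine Measure.integrableOn_of_bounded (M := C) ?_ hFm.aestronglyMeasurable ?_
    · exact ((isCompact_Icc.prod isCompact_Icc).measure_lt_top).ne
    · exact (ae_restrict_iff' (measurableSet_Icc.prod measurableSet_Icc)).2
        (Eventually.of_forall hC)
  have hint2 : Integrable F ((volume.restrict (Icc s t)).prod volume) := by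
    have : IntegrableOn F (Icc s t ×ˢ univ) (volume.prod volume) := by
      refine hint.of_forall_sdiff_eq_zero (measurableSet_Icc.prod MeasurableSet.univ) ?_
      rintro q ⟨hq1, hq2⟩
      have : R ≤ |q.2| := by
        by_contra hcon
        exact hq2 ⟨hq1.1, (abs_le.1 (not_le.1 hcon).le)⟩
      simp [hF, hR _ this, hR' _ this]
    rw [IntegrableOn, ← Measure.prod_restrict, Measure.restrict_univ] at this
    exact this
  exact hint2.integral_prod_left

/-- Testing the weak equation with functions of `x` only. -/
lemma integral_mul_eq_of_weak {v w g : ℝ → ℝ → ℝ}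
    (hv : Continuous fun q : ℝ × ℝ => v q.1 q.2)
    (hw : Continuous fun q : ℝ × ℝ => w q.1 q.2)
    (hgm : Measurable fun q : ℝ × ℝ => g q.1 q.2)
    (hgb : ∀ T : ℝ, ∃ C : ℝ, ∀ x : ℝ, ∀ t ≤ T, |g x t| ≤ C)
    (hweak : ∀ T > (0:ℝ), ∀ φ φt φx : ℝ → ℝ → ℝ, IsTestFun T φ φt φx →
      (∫ t in Set.Ioc (0:ℝ) T, ∫ x : ℝ, φt x t * v x t)
        = ∫ t in Set.Ioc (0:ℝ) T, ∫ x : ℝ, (φx x t * w x t + g x t * φ x t))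
    {φ φ' : ℝ → ℝ} (hφ : ∀ x, HasDerivAt φ (φ' x) x) (hφ' : Continuous φ') {R : ℝ}
    (hR : ∀ x, R ≤ |x| → φ x = 0) (hR' : ∀ x, R ≤ |x| → φ' x = 0) {T : ℝ} (hT : 0 ≤ T) :
    ∫ x, φ x * v x T = -∫ t in (0:ℝ)..T, ∫ x, (φ' x * w x t + g x t * φ x) := by
  have hφc : Continuous φ := continuous_iff_continuousAt.2 fun x => (hφ x).continuousAt
  have hac : Continuous fun t => ∫ x, φ x * v x t := by
    have : (fun t => ∫ x, φ x * v x t) = fun t => ∫ x in Icc (-R) R, φ x * v x t := by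
      funext t
      refine (setIntegral_eq_integral_of_forall_compl_eq_zero fun x hx => ?_).symm
      have : R ≤ |x| := by
        by_contra hcon
        exact hx (abs_le.1 (not_le.1 hcon).le)
      simp [hR _ this]
    rw [this]
    refine continuous_parametric_integral_of_continuous ?_ isCompact_Icc
    have h1 : Continuous fun q : ℝ × ℝ => v q.2 q.1 := hv.comp continuous_swap
    exact (hφc.comp continuous_snd).mul h1
  have hpos : ∀ T > 0, ∫ x, φ x * v x T
      = -∫ t in (0:ℝ)..T, ∫ x, (φ' x * w x t + g x t * φ x) := by
    intro T hT
    refine eq_neg_integral_of_weak (a := fun t => ∫ x, φ x * v x t) hT hac (fun t =>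
      intervalIntegrable_integral_test hw hgm hgb hφc hφ' hR hR' 0 t) ?_
    intro θ θ' hθ' hθ hθT
    have hθc : Continuous θ := continuous_iff_continuousAt.2 fun x => (hθ x).continuousAt
    have := hweak T hT (fun x t => φ x * θ t) (fun x t => φ x * θ' t) (fun x t => φ' x * θ t)
      ⟨fun x t _ => ((hθ t).const_mul _).hasDerivWithinAt, fun x t _ => (hφ x).mul_const _,
        by fun_prop, by fun_prop, by fun_prop,
        ⟨R, fun x t _ hx => by simp [hR x hx]⟩, fun x => by simp [hθT]⟩
    have h1 : ∀ t, ∫ x, φ x * θ' t * v x t = θ' t * ∫ x, φ x * v x t := fun t => by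
      rw [← integral_const_mul]
      congr 1; funext x; ring
    have h2 : ∀ t, ∫ x, (φ' x * θ t * w x t + g x t * (φ x * θ t))
        = θ t * ∫ x, (φ' x * w x t + g x t * φ x) := fun t => by
      rw [← integral_const_mul]
      congr 1; funext x; ring
    simp only [h1, h2] at this
    rw [intervalIntegral.integral_of_le hT.le, intervalIntegral.integral_of_le hT.le]
    exact this
  rcases hT.eq_or_lt with rfl | hT
  · have hBc : Continuous fun T => -∫ t in (0:ℝ)..T, ∫ x, (φ' x * w x t + g x t * φ x) :=
      (intervalIntegral.continuous_primitive (fun s t =>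
        intervalIntegrable_integral_test hw hgm hgb hφc hφ' hR hR' s t) 0).neg
    have h1 := hac.continuousWithinAt (s := Ioi 0) (x := 0)
    have h2 := hBc.continuousWithinAt (s := Ioi 0) (x := 0)
    exact tendsto_nhds_unique (h1.tendsto.congr' (by
      filter_upwards [self_mem_nhdsWithin] with t ht using hpos t ht)) h2.tendsto
  · exact hpos T hT

lemma hasDerivAt_max_zero_pow (n : ℕ) (y : ℝ) :
    HasDerivAt (fun y : ℝ => max y 0 ^ (n + 2)) ((n + 2 : ℝ) * max y 0 ^ (n + 1)) y := by
  rcases lt_trichotomy y 0 with hy | rfl | hy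
  · have h0 : max y 0 = 0 := max_eq_right hy.le
    rw [h0]
    simp only [ne_eq, Nat.add_eq_zero_iff, one_ne_zero, and_false, not_false_eq_true, zero_pow,
      mul_zero]
    refine (hasDerivAt_const y (0:ℝ)).congr_of_eventuallyEq ?_
    filter_upwards [eventually_lt_nhds hy] with z hz
    simp [max_eq_right hz.le]
  · have : HasDerivAt (fun y : ℝ => max y 0 ^ (n + 2)) 0 0 := by
      rw [hasDerivAt_iff_hasFDerivAt]
      have := Asymptotics.IsBigO.hasFDerivAt (𝕜 := ℝ) (n := n + 2)
        (Asymptotics.IsBigO.of_bound 1 (f := fun y : ℝ => max y 0 ^ (n + 2))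
        (g := fun y : ℝ => ‖y - 0‖ ^ (n + 2)) (l := nhds 0)
        (Eventually.of_forall fun y => ?_)) (by omega)
      · simpa using this
      · simp only [norm_pow, sub_zero, norm_norm, one_mul]
        gcongr
        rw [Real.norm_eq_abs, Real.norm_eq_abs, abs_of_nonneg (le_max_right _ _)]
        exact max_le (le_abs_self y) (abs_nonneg y)
    simpa using this
  · have h0 : max y 0 = y := max_eq_left hy.le
    rw [h0]
    have := hasDerivAt_pow (n + 2) y
    push_cast at this
    refine (this).congr_of_eventuallyEq ?_
    filter_upwards [eventually_gt_nhds hy] with z hz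
    simp [max_eq_left hz.le]

lemma max_zero_pow_three_sub_le (a b : ℝ) :
    max a 0 ^ 3 - max b 0 ^ 3 ≤ 3 * max a 0 ^ 2 * (a - b) := by
  rcases le_total a 0 with ha | ha <;> rcases le_total b 0 with hb | hb
  · simp [ha, hb]
  · simp only [max_eq_right ha, max_eq_left hb]
    have : 0 ≤ b ^ 3 := by positivity
    linarith
  · simp only [max_eq_right hb, max_eq_left ha]
    nlinarith [pow_nonneg ha 3, mul_nonneg (sq_nonneg a) (neg_nonneg.2 hb)]
  · simp only [max_eq_left ha, max_eq_left hb]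
    nlinarith [mul_nonneg (sq_nonneg (a - b)) ha, mul_nonneg (sq_nonneg (a - b)) hb]

/-- A function whose increments are `o(h)` from above does not increase. -/
lemma le_of_small_increments {E : ℝ → ℝ} {a b : ℝ} (hab : a ≤ b)
    (h : ∀ η > 0, ∃ h₀ > 0, ∀ t ∈ Icc a b, ∀ t' ∈ Icc a b, t ≤ t' → t' - t ≤ h₀ →
      E t' - E t ≤ η * (t' - t)) : E b ≤ E a := by
  suffices key : ∀ η > 0, E b - E a ≤ η * (b - a) by
    refine le_of_forall_pos_le_add fun ε hε => ?_
    have h1 : 0 < b - a + 1 := by linarith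
    have := key (ε / (b - a + 1)) (by positivity)
    have h2 : ε / (b - a + 1) * (b - a) ≤ ε := by
      rw [div_mul_eq_mul_div, div_le_iff₀ h1]
      nlinarith
    linarith
  intro η hη
  obtain ⟨h₀, hh₀, hstep⟩ := h η hη
  obtain ⟨n, hn⟩ := exists_nat_gt ((b - a) / h₀)
  have hn0 : (0:ℝ) < n := lt_of_le_of_lt (div_nonneg (by linarith) hh₀.le) hn
  set d := (b - a) / n with hd
  have hd0 : 0 ≤ d := div_nonneg (by linarith) hn0.le
  have hdn : n * d = b - a := by rw [hd]; field_simp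
  have hdh : d ≤ h₀ := by
    rw [hd, div_le_iff₀ hn0]
    rw [div_lt_iff₀ hh₀] at hn
    linarith
  have hind : ∀ k : ℕ, k ≤ n → E (a + k * d) - E a ≤ η * (k * d) := by
    intro k
    induction k with
    | zero => simp
    | succ k ih =>
      intro hk
      have h1 := ih (by omega)
      have hk1 : ((k : ℝ) + 1) * d ≤ b - a := by
        rw [← hdn]; gcongr; exact_mod_cast hk
      have hk0 : 0 ≤ (k : ℝ) * d := by positivity
      have h2 := hstep (a + k * d) ⟨by linarith, by linarith⟩ (a + (k + 1) * d)
        ⟨by linarith, by linarith⟩ (by linarith) (by linarith)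
      push_cast
      nlinarith
  have := hind n le_rfl
  rwa [hdn, add_sub_cancel] at this

lemma exists_uniform_in_time {F : ℝ → ℝ → ℝ} {L a b : ℝ}
    (hF : ContinuousOn (fun q : ℝ × ℝ => F q.1 q.2) (univ ×ˢ Icc a b)) {η : ℝ} (hη : 0 < η) :
    ∃ h₀ > 0, ∀ x, |x| ≤ L → ∀ t ∈ Icc a b, ∀ s ∈ Icc a b, |t - s| ≤ h₀ →
      |F x t - F x s| ≤ η := by
  have hK : IsCompact (Icc (-L) L ×ˢ Icc a b) := isCompact_Icc.prod isCompact_Icc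
  have hu := hK.uniformContinuousOn_of_continuous
    (hF.mono (prod_mono (subset_univ _) subset_rfl))
  obtain ⟨δ, hδ, hd⟩ := Metric.uniformContinuousOn_iff.1 hu η hη
  refine ⟨δ / 2, by positivity, fun x hx t ht s hs hts => ?_⟩
  have := hd (x, t) ⟨abs_le.1 hx, ht⟩ (x, s) ⟨abs_le.1 hx, hs⟩ (by
    rw [Prod.dist_eq, dist_self, Real.dist_eq]
    exact max_lt hδ (by linarith))
  rw [Real.dist_eq] at this
  exact this.le

/-- `v` is a weak solution of `v_t = v_xx - g` on `ℝ × [0, ∞)` with `v = 0` at `t = 0`, where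
`w` is the spatial derivative of `v`. -/
structure IsWeakHeat (v w g : ℝ → ℝ → ℝ) : Prop where
  cont : Continuous fun q : ℝ × ℝ => v q.1 q.2
  cont_deriv : Continuous fun q : ℝ × ℝ => w q.1 q.2
  hasDerivAt : ∀ x t, HasDerivAt (fun y => v y t) (w x t) x
  measurable : Measurable fun q : ℝ × ℝ => g q.1 q.2
  bound : ∀ T : ℝ, ∃ C : ℝ, ∀ x : ℝ, ∀ t ≤ T, |g x t| ≤ C
  weak : ∀ φ φ' : ℝ → ℝ, (∀ x, HasDerivAt φ (φ' x) x) → Continuous φ' → ∀ R : ℝ,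
    (∀ x, R ≤ |x| → φ x = 0) → (∀ x, R ≤ |x| → φ' x = 0) → ∀ T : ℝ, 0 ≤ T →
      ∫ x, φ x * v x T = -∫ t in (0:ℝ)..T, ∫ x, (φ' x * w x t + g x t * φ x)

lemma hasCompactSupport_of_abs_ge {φ : ℝ → ℝ} {R : ℝ} (hR : ∀ x, R ≤ |x| → φ x = 0) :
    HasCompactSupport φ :=
  HasCompactSupport.intro (isCompact_Icc (a := -R) (b := R)) fun x hx => hR x (by
    by_contra hcon
    exact hx (abs_le.1 (not_le.1 hcon).le))

/-- Comparison with a supersolution `V`, which only needs to be one where it is exceeded. -/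
lemma IsWeakHeat.le_supersolution {v w g V Vt Vx Vxx : ℝ → ℝ → ℝ} (h : IsWeakHeat v w g)
    {T₀ T₁ L : ℝ} (hT₀ : 0 ≤ T₀) (hL : 0 ≤ L)
    (hVx : ∀ t ∈ Icc T₀ T₁, ∀ x, HasDerivAt (fun y => V y t) (Vx x t) x)
    (hVxx : ∀ t ∈ Icc T₀ T₁, ∀ x, HasDerivAt (fun y => Vx y t) (Vxx x t) x)
    (hVxxc : ∀ t ∈ Icc T₀ T₁, Continuous fun x => Vxx x t)
    (hVt : ∀ x, ∀ t ∈ Icc T₀ T₁, HasDerivAt (fun s => V x s) (Vt x t) t)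
    (hVc : ContinuousOn (fun q : ℝ × ℝ => V q.1 q.2) (univ ×ˢ Icc T₀ T₁))
    (hVxc : ContinuousOn (fun q : ℝ × ℝ => Vx q.1 q.2) (univ ×ˢ Icc T₀ T₁))
    (hVtc : ContinuousOn (fun q : ℝ × ℝ => Vt q.1 q.2) (univ ×ˢ Icc T₀ T₁))
    (hinit : ∀ x, v x T₀ ≤ V x T₀)
    (hout : ∀ t ∈ Icc T₀ T₁, ∀ x, L ≤ |x| → v x t ≤ V x t)
    (hrate : ∀ η > 0, ∃ h₀ > 0, ∀ t ∈ Icc T₀ T₁, ∀ t' ∈ Icc T₀ T₁, t ≤ t' → t' - t ≤ h₀ →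
      ∀ s ∈ Icc t t', ∀ᵐ x, V x t' < v x t' → Vxx x t - Vt x t - η ≤ g x s) :
    ∀ t ∈ Icc T₀ T₁, ∀ x, v x t ≤ V x t := by
  set P : ℝ → ℝ → ℝ := fun x t => max (v x t - V x t) 0 with hP
  have hP0 : ∀ x t, 0 ≤ P x t := fun x t => le_max_right _ _
  have hPout : ∀ t ∈ Icc T₀ T₁, ∀ x, L ≤ |x| → P x t = 0 := fun t ht x hx =>
    max_eq_right (sub_nonpos.2 (hout t ht x hx))
  have hslice : ∀ (F : ℝ → ℝ → ℝ), ContinuousOn (fun q : ℝ × ℝ => F q.1 q.2)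
      (univ ×ˢ Icc T₀ T₁) → ∀ t ∈ Icc T₀ T₁, Continuous fun x => F x t := fun F hF t ht => by
    refine hF.comp_continuous (f := fun x => (x, t)) (by fun_prop) fun x => ⟨mem_univ _, ht⟩
  have hPc : ContinuousOn (fun q : ℝ × ℝ => P q.1 q.2) (univ ×ˢ Icc T₀ T₁) :=
    (h.cont.continuousOn.sub hVc).sup continuousOn_const
  have hvs : ∀ t, Continuous fun x => v x t := fun t => h.cont.comp (Continuous.prodMk_left t)
  have hws : ∀ t, Continuous fun x => w x t := fun t => h.cont_deriv.comp (Continuous.prodMk_left t)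
  obtain ⟨M, hM0, hM⟩ : ∃ M ≥ 0, ∀ x, |x| ≤ L → ∀ t ∈ Icc T₀ T₁,
      3 * P x t ^ 2 ≤ M ∧ |6 * P x t * (w x t - Vx x t)| ≤ M := by
    have hK : IsCompact (Icc (-L) L ×ˢ Icc T₀ T₁) := isCompact_Icc.prod isCompact_Icc
    have hF : ContinuousOn (fun q : ℝ × ℝ => 3 * P q.1 q.2 ^ 2
        + |6 * P q.1 q.2 * (w q.1 q.2 - Vx q.1 q.2)|) (univ ×ˢ Icc T₀ T₁) :=
      (continuousOn_const.mul (hPc.pow 2)).add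
        ((continuousOn_const.mul hPc).mul (h.cont_deriv.continuousOn.sub hVxc)).abs
    obtain ⟨M, hM⟩ := hK.bddAbove_image (hF.mono (prod_mono (subset_univ _) subset_rfl))
    refine ⟨max M 0, le_max_right _ _, fun x hx t ht => ?_⟩
    have := hM ⟨(x, t), ⟨abs_le.1 hx, ht⟩, rfl⟩
    change _ ≤ M at this
    have h1 : 0 ≤ 3 * P x t ^ 2 := by positivity
    have h2 := abs_nonneg (6 * P x t * (w x t - Vx x t))
    exact ⟨le_max_of_le_left (by linarith), le_max_of_le_left (by linarith)⟩
  set E : ℝ → ℝ := fun t => ∫ x, P x t ^ 3 with hE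
  have hPcs : ∀ t ∈ Icc T₀ T₁, ∀ n : ℕ, n ≠ 0 → Integrable fun x => P x t ^ n :=
    fun t ht n hn => ((hslice P hPc t ht).pow n).integrable_of_hasCompactSupport
      (hasCompactSupport_of_abs_ge (R := L) fun x hx => by simp [hPout t ht x hx, hn])
  have hstep : ∀ η > 0, ∃ h₀ > 0, ∀ t ∈ Icc T₀ T₁, ∀ t' ∈ Icc T₀ T₁, t ≤ t' → t' - t ≤ h₀ →
      E t' - E t ≤ 8 * M * L * η * (t' - t) := by
    intro η hη
    obtain ⟨h₁, hh₁, hu₁⟩ := exists_uniform_in_time (L := L) (a := T₀) (b := T₁)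
      h.cont_deriv.continuousOn hη
    obtain ⟨h₂, hh₂, hu₂⟩ := exists_uniform_in_time (L := L) hVxc hη
    obtain ⟨h₃, hh₃, hu₃⟩ := exists_uniform_in_time (L := L) hVtc hη
    obtain ⟨h₄, hh₄, hu₄⟩ := hrate η hη
    refine ⟨min (min h₁ h₂) (min h₃ h₄), by positivity, fun t ht t' ht' htt hth => ?_⟩
    simp only [le_min_iff] at hth
    obtain ⟨⟨hth₁, hth₂⟩, hth₃, hth₄⟩ := hth
    set φ : ℝ → ℝ := fun x => 3 * P x t' ^ 2 with hφ
    set φ' : ℝ → ℝ := fun x => 6 * P x t' * (w x t' - Vx x t') with hφ'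
    have hφ0 : ∀ x, 0 ≤ φ x := fun x => by positivity
    have hφd : ∀ x, HasDerivAt φ (φ' x) x := fun x => by
      have h1 := (h.hasDerivAt x t').sub (hVx t' ht' x)
      have h2 := ((hasDerivAt_max_zero_pow 0 (v x t' - V x t')).comp x h1).const_mul 3
      refine h2.congr_deriv ?_
      change _ = 6 * max (v x t' - V x t') 0 * _
      push_cast
      ring
    have hφc : Continuous φ := continuous_iff_continuousAt.2 fun x => (hφd x).continuousAt
    have hφ'c : Continuous φ' :=
      (continuous_const.mul (hslice P hPc t' ht')).mul ((hws t').sub (hslice Vx hVxc t' ht'))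
    have hφR : ∀ x, L ≤ |x| → φ x = 0 := fun x hx => by simp [hφ, hPout t' ht' x hx]
    have hφR' : ∀ x, L ≤ |x| → φ' x = 0 := fun x hx => by simp [hφ', hPout t' ht' x hx]
    have hcs := hasCompactSupport_of_abs_ge hφR
    have hcs' := hasCompactSupport_of_abs_ge hφR'
    have hint : ∀ F : ℝ → ℝ, Continuous F → Integrable fun x => φ x * F x := fun F hF =>
      (hφc.mul hF).integrable_of_hasCompactSupport hcs.mul_right
    have hint' : ∀ F : ℝ → ℝ, Continuous F → Integrable fun x => φ' x * F x := fun F hF =>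
      (hφ'c.mul hF).integrable_of_hasCompactSupport hcs'.mul_right
    have hφi : Integrable φ := hφc.integrable_of_hasCompactSupport hcs
    have hVts := hslice Vt hVtc t ht
    have hVxs := hslice Vx hVxc t ht
    set χ : ℝ → ℝ := (Icc (-L) L).indicator fun _ => (1:ℝ) with hχ
    have hχi : Integrable χ := (integrable_indicator_iff measurableSet_Icc).2
      (integrableOn_const (by simp) (by simp))
    have hχint : ∫ x, χ x = 2 * L := by
      rw [hχ, integral_indicator measurableSet_Icc]
      simp [hL]; ring
    have hχin : ∀ x, |x| ≤ L → χ x = 1 := fun x hx =>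
      indicator_of_mem (show x ∈ Icc (-L) L from abs_le.1 hx) _
    have hχ0 : ∀ x, 0 ≤ χ x := fun x => indicator_nonneg (fun _ _ => zero_le_one) x
    have hφint : ∫ x, φ x ≤ M * (2 * L) := by
      rw [← hχint, ← integral_const_mul]
      refine integral_mono hφi (hχi.const_mul _) fun x => ?_
      rcases le_total L |x| with hx | hx
      · simp only [hφR x hx]; exact mul_nonneg hM0 (hχ0 x)
      · simp only [hχin x hx, mul_one]; exact (hM x hx t' ht').1
    -- increment of the energy
    have hconv : E t' - E t ≤ ∫ x, (φ x * v x t' - φ x * v x t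
        - (t' - t) * (φ x * Vt x t - η * φ x)) := by
      rw [hE, ← integral_sub (hPcs t' ht' 3 (by simp)) (hPcs t ht 3 (by simp))]
      refine integral_mono ((hPcs t' ht' 3 (by simp)).sub (hPcs t ht 3 (by simp)))
        (((hint _ (hvs t')).sub (hint _ (hvs t))).sub
          (((hint _ hVts).sub (hφi.const_mul η)).const_mul _)) fun x => ?_
      simp only
      rcases le_total L |x| with hx | hx
      · simp [hφR x hx, hPout t ht x hx, hPout t' ht' x hx]
      · have h1 := max_zero_pow_three_sub_le (v x t' - V x t') (v x t - V x t)
        have h2 : (t' - t) * (Vt x t - η) ≤ V x t' - V x t := by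
          rcases htt.eq_or_lt with rfl | hlt
          · simp
          obtain ⟨c, hc, hce⟩ := exists_hasDerivAt_eq_slope (fun s => V x s) (fun s => Vt x s) hlt
            (fun s hs => (hVt x s ⟨ht.1.trans hs.1, hs.2.trans ht'.2⟩).continuousAt.continuousWithinAt)
            (fun s hs => hVt x s ⟨ht.1.trans hs.1.le, hs.2.le.trans ht'.2⟩)
          have h3 := hu₃ x hx t ht c ⟨ht.1.trans hc.1.le, hc.2.le.trans ht'.2⟩ (by
            rw [abs_sub_comm, abs_of_nonneg] <;> linarith [hc.1, hc.2])
          rw [eq_div_iff (by linarith)] at hce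
          rw [← hce, mul_comm]
          have := (abs_le.1 h3).2
          exact mul_le_mul_of_nonneg_right (by linarith) (by linarith)
        have h3 := mul_le_mul_of_nonneg_left h2 (hφ0 x)
        change P x t' ^ 3 - P x t ^ 3 ≤ φ x * _ at h1
        nlinarith
    have hsum : ∫ x, (φ x * v x t' - φ x * v x t - (t' - t) * (φ x * Vt x t - η * φ x))
        = (∫ x, φ x * v x t') - (∫ x, φ x * v x t)
          - (t' - t) * ((∫ x, φ x * Vt x t) - η * ∫ x, φ x) := by
      have hi1 : Integrable fun x => φ x * v x t' - φ x * v x t :=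
        (hint _ (hvs t')).sub (hint _ (hvs t))
      have hi2 : Integrable fun x => (t' - t) * (φ x * Vt x t - η * φ x) :=
        ((hint _ hVts).sub (hφi.const_mul η)).const_mul _
      rw [integral_sub hi1 hi2, integral_sub (hint _ (hvs t')) (hint _ (hvs t)), integral_const_mul,
        integral_sub (hint _ hVts) (hφi.const_mul η), integral_const_mul]
    have hii : ∀ a b, IntervalIntegrable (fun s => ∫ x, (φ' x * w x s + g x s * φ x)) volume a b :=
      intervalIntegrable_integral_test h.cont_deriv h.measurable h.bound hφc hφ'c hφR hφR'
    have hwk : (∫ x, φ x * v x t') - (∫ x, φ x * v x t)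
        = -∫ s in t..t', ∫ x, (φ' x * w x s + g x s * φ x) := by
      rw [h.weak φ φ' hφd hφ'c L hφR hφR' t' (hT₀.trans ht'.1),
        h.weak φ φ' hφd hφ'c L hφR hφR' t (hT₀.trans ht.1),
        ← intervalIntegral.integral_interval_sub_left (hii 0 t') (hii 0 t)]
      ring
    -- lower bound for the flux at each time
    have hpartsx : ∫ x, φ x * Vxx x t = -∫ x, φ' x * Vx x t :=
      integral_mul_deriv_eq_deriv_mul_of_integrable (fun x _ => hφd x)
        (fun x _ => hVxx t ht x) (hint _ (hVxxc t ht)) (hint' _ hVxs) (hint _ hVxs)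
    have hlow : ∀ s ∈ Icc t t', -(∫ x, φ x * Vt x t) - η * (M * (2 * L)) - 2 * M * η * (2 * L)
        ≤ ∫ x, (φ' x * w x s + g x s * φ x) := by
      intro s hs
      have hsI : s ∈ Icc T₀ T₁ := ⟨ht.1.trans hs.1, hs.2.trans ht'.2⟩
      have hgi : Integrable fun x => g x s * φ x := by
        obtain ⟨C, hC⟩ := h.bound s
        refine hφi.bdd_mul (c := C) ?_ (Eventually.of_forall fun x => hC x s le_rfl)
        exact (h.measurable.comp (measurable_id.prodMk measurable_const)).aestronglyMeasurable
      have hi1 : Integrable fun x => φ' x * Vx x t + φ x * Vxx x t :=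
        (hint' _ hVxs).add (hint _ (hVxxc t ht))
      have hi2 : Integrable fun x => φ x * Vt x t + η * φ x :=
        (hint _ hVts).add (hφi.const_mul η)
      have hi3 : Integrable fun x => 2 * M * η * χ x := hχi.const_mul _
      have : ∫ x, ((φ' x * Vx x t + φ x * Vxx x t) - (φ x * Vt x t + η * φ x)
          - 2 * M * η * χ x) ≤ ∫ x, (φ' x * w x s + g x s * φ x) := by
        refine integral_mono_ae ((hi1.sub hi2).sub hi3) ((hint' _ (hws s)).add hgi) ?_
        filter_upwards [hu₄ t ht t' ht' htt hth₄ s hs] with x hx4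
        rcases le_total L |x| with hx | hx
        · have := mul_nonneg (mul_nonneg (mul_nonneg zero_le_two hM0) hη.le) (hχ0 x)
          simp only [hφR x hx, hφR' x hx]
          linarith
        · have h1 : φ x * (Vxx x t - Vt x t - η) ≤ φ x * g x s := by
            by_cases hpos : V x t' < v x t'
            · exact mul_le_mul_of_nonneg_left (hx4 hpos) (hφ0 x)
            · have : φ x = 0 := by
                simp [hφ, hP, max_eq_right (sub_nonpos.2 (not_lt.1 hpos))]
              simp [this]
          have h2 : 0 ≤ φ' x * (w x t' - Vx x t') := by
            have : φ' x * (w x t' - Vx x t') = 6 * P x t' * (w x t' - Vx x t') ^ 2 := by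
              simp only [hφ']; ring
            rw [this]
            exact mul_nonneg (mul_nonneg (by norm_num) (hP0 _ _)) (sq_nonneg _)
          have h3 : |φ' x * ((w x t' - w x s) + (Vx x t - Vx x t'))| ≤ M * (η + η) := by
            rw [abs_mul]
            refine mul_le_mul (hM x hx t' ht').2 ((abs_add_le _ _).trans (add_le_add ?_ ?_))
              (abs_nonneg _) hM0
            · exact hu₁ x hx t' ht' s hsI (by
                rw [abs_of_nonneg] <;> linarith [hs.1, hs.2])
            · exact hu₂ x hx t ht t' ht' (by
                rw [abs_sub_comm, abs_of_nonneg] <;> linarith)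
          have h4 := (abs_le.1 h3).2
          simp only [hχin x hx]
          nlinarith
      have hi4 : Integrable fun x =>
          (φ' x * Vx x t + φ x * Vxx x t) - (φ x * Vt x t + η * φ x) := hi1.sub hi2
      rw [integral_sub hi4 hi3, integral_sub hi1 hi2,
        integral_add (hint' _ hVxs) (hint _ (hVxxc t ht)), hpartsx,
        integral_add (hint _ hVts) (hφi.const_mul η), integral_const_mul η φ,
        integral_const_mul (2 * M * η) χ, hχint] at this
      have := mul_le_mul_of_nonneg_left hφint hη.le
      linarith
    have hlow' := intervalIntegral.integral_mono_on htt intervalIntegrable_const (hii t t') hlow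
    rw [intervalIntegral.integral_const, smul_eq_mul] at hlow'
    rw [hsum, hwk] at hconv
    have h5 := mul_le_mul_of_nonneg_left hφint (mul_nonneg (sub_nonneg.2 htt) hη.le)
    linarith
  intro t ht x
  have hEt : E t ≤ E T₀ := by
    refine le_of_small_increments ht.1 fun η hη => ?_
    have hpos : 0 < 8 * M * L + 1 := by positivity
    obtain ⟨h₀, hh₀, hs⟩ := hstep (η / (8 * M * L + 1)) (by positivity)
    refine ⟨h₀, hh₀, fun a ha b hb hab hh => (hs a ⟨ha.1, ha.2.trans ht.2⟩ b
      ⟨hb.1, hb.2.trans ht.2⟩ hab hh).trans ?_⟩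
    refine mul_le_mul_of_nonneg_right ?_ (by linarith)
    rw [mul_div_assoc', div_le_iff₀ hpos]
    nlinarith
  have hE0 : E T₀ = 0 := by
    have : ∀ x, P x T₀ = 0 := fun x => max_eq_right (sub_nonpos.2 (hinit x))
    simp [hE, this]
  by_contra hcon
  have hPpos : P x t ≠ 0 := (lt_max_of_lt_left (sub_pos.2 (not_le.1 hcon))).ne'
  have : 0 < E t := Continuous.integral_pos_of_hasCompactSupport_nonneg_nonzero
    ((hslice P hPc t ht).pow 3)
    (hasCompactSupport_of_abs_ge (R := L) fun x hx => by simp [hPout t ht x hx])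
    (fun x => pow_nonneg (hP0 x t) 3) (x := x) (pow_ne_zero 3 hPpos)
  linarith

/-- The profile of `psi` in similarity coordinates, continued analytically to all of `ℝ`. -/
def profile (α β η : ℝ) : ℝ :=
  (α * β / 2) * Real.exp (α ^ 2 / 4) * ∫ ζ in Ioi η, Real.exp (-ζ ^ 2 / 4)

lemma psi_of_pos {α β x t : ℝ} (ht : 0 < t) :
    psi α β x t = profile α β (max (|x| / √t) α) := if_pos ht

lemma psi_of_nonpos {α β x t : ℝ} (ht : t ≤ 0) : psi α β x t = 0 := if_neg ht.not_gt

lemma integrable_exp_neg_sq_div_four : Integrable fun ζ : ℝ => Real.exp (-ζ ^ 2 / 4) := by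
  convert integrable_exp_neg_mul_sq (b := 1 / 4) (by norm_num) using 3
  ring

lemma hasDerivAt_profile (α β η : ℝ) : HasDerivAt (profile α β)
    (-((α * β / 2) * Real.exp (α ^ 2 / 4) * Real.exp (-η ^ 2 / 4))) η := by
  have hc : Continuous fun ζ : ℝ => Real.exp (-ζ ^ 2 / 4) := by fun_prop
  have h1 : profile α β = fun η => (α * β / 2) * Real.exp (α ^ 2 / 4) *
      ((∫ ζ in Ioi (0:ℝ), Real.exp (-ζ ^ 2 / 4)) - ∫ ζ in (0:ℝ)..η, Real.exp (-ζ ^ 2 / 4)) := by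
    funext η
    rw [profile, ← intervalIntegral.integral_Ioi_sub_Ioi'
      integrable_exp_neg_sq_div_four.integrableOn integrable_exp_neg_sq_div_four.integrableOn]
    ring
  rw [h1]
  refine (((hc.integral_hasStrictDerivAt 0 η).hasDerivAt.const_sub _).const_mul _).congr_deriv ?_
  ring

lemma continuous_profile (α β : ℝ) : Continuous (profile α β) :=
  continuous_iff_continuousAt.2 fun η => (hasDerivAt_profile α β η).continuousAt

lemma profile_nonneg {α β : ℝ} (hα : 0 ≤ α) (hβ : 0 ≤ β) (η : ℝ) : 0 ≤ profile α β η :=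
  mul_nonneg (by positivity) (integral_nonneg fun _ => (Real.exp_pos _).le)

lemma antitone_profile {α β : ℝ} (hα : 0 ≤ α) (hβ : 0 ≤ β) : Antitone (profile α β) :=
  antitone_of_deriv_nonpos (fun η => (hasDerivAt_profile α β η).differentiableAt) fun η => by
    rw [(hasDerivAt_profile α β η).deriv, neg_nonpos]
    positivity

lemma profile_sub_le {α β y : ℝ} (hα : 0 ≤ α) (hβ : 0 ≤ β) (hy : 0 ≤ y) :
    profile α β (α - y) - profile α β α ≤ (α * β / 2) * Real.exp (α ^ 2 / 4) * y := by
  have h : Monotone fun η => profile α β η + (α * β / 2) * Real.exp (α ^ 2 / 4) * η := by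
    have hd := fun η => (hasDerivAt_profile α β η).add
      ((hasDerivAt_id η).const_mul ((α * β / 2) * Real.exp (α ^ 2 / 4)))
    refine monotone_of_deriv_nonneg (fun η => (hd η).differentiableAt) fun η => ?_
    refine le_of_le_of_eq ?_ (hd η).deriv.symm
    have h1 : Real.exp (-η ^ 2 / 4) ≤ 1 := Real.exp_le_one_iff.2 (by nlinarith [sq_nonneg η])
    have h2 : 0 ≤ (α * β / 2) * Real.exp (α ^ 2 / 4) := by positivity
    nlinarith
  have := h (show α - y ≤ α by linarith)
  simp only at this
  linarith

lemma profile_le_exp {α β η : ℝ} (hα : 0 < α) (hβ : 0 ≤ β) (hη : α ≤ η) :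
    profile α β η ≤ β * Real.exp (α ^ 2 / 4) * Real.exp (-η ^ 2 / 4) := by
  have hd : ∀ x ∈ Ici η, HasDerivAt (fun ζ => -(2 / α) * Real.exp (-ζ ^ 2 / 4))
      (x / α * Real.exp (-x ^ 2 / 4)) x := fun x _ => by
    have h1 : HasDerivAt (fun ζ : ℝ => -ζ ^ 2 / 4) (-(2 * x) / 4) x := by
      simpa using ((hasDerivAt_pow 2 x).neg.div_const 4)
    refine (h1.exp.const_mul _).congr_deriv ?_
    field_simp
    ring
  have hlim : Tendsto (fun ζ => -(2 / α) * Real.exp (-ζ ^ 2 / 4)) atTop (nhds 0) := by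
    rw [← mul_zero (-(2 / α))]
    refine Tendsto.const_mul _ (Real.tendsto_exp_atBot.comp ?_)
    have : Tendsto (fun ζ : ℝ => ζ ^ 2 / 4) atTop atTop :=
      (tendsto_pow_atTop two_ne_zero).atTop_div_const (by norm_num)
    refine (tendsto_neg_atTop_atBot.comp this).congr fun x => ?_
    simp only [Function.comp]
    ring
  have hpos : ∀ x ∈ Ioi η, 0 ≤ x / α * Real.exp (-x ^ 2 / 4) := fun x hx =>
    mul_nonneg (div_nonneg (hα.le.trans (hη.trans (le_of_lt hx))) hα.le) (Real.exp_pos _).le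
  have hi := integrableOn_Ioi_deriv_of_nonneg' hd hpos hlim
  have he := integral_Ioi_of_hasDerivAt_of_nonneg' hd hpos hlim
  have : ∫ ζ in Ioi η, Real.exp (-ζ ^ 2 / 4) ≤ 2 / α * Real.exp (-η ^ 2 / 4) := by
    refine (setIntegral_mono_on integrable_exp_neg_sq_div_four.integrableOn hi measurableSet_Ioi
      fun x hx => ?_).trans (by rw [he]; linarith)
    refine le_mul_of_one_le_left (Real.exp_pos _).le ?_
    rw [one_le_div hα]
    exact hη.trans (le_of_lt hx)
  refine (mul_le_mul_of_nonneg_left this (by positivity)).trans (le_of_eq ?_)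
  field_simp

lemma psi_nonneg {α β : ℝ} (hα : 0 ≤ α) (hβ : 0 ≤ β) (x t : ℝ) : 0 ≤ psi α β x t := by
  rcases lt_or_ge 0 t with ht | ht
  · rw [psi_of_pos ht]; exact profile_nonneg hα hβ _
  · rw [psi_of_nonpos ht]

lemma psi_le {α β : ℝ} (hα : 0 ≤ α) (hβ : 0 ≤ β) (x t : ℝ) : psi α β x t ≤ profile α β α := by
  rcases lt_or_ge 0 t with ht | ht
  · rw [psi_of_pos ht]; exact antitone_profile hα hβ (le_max_right _ _)
  · rw [psi_of_nonpos ht]; exact profile_nonneg hα hβ _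

lemma psi_le_exp {α β : ℝ} (hα : 0 < α) (hβ : 0 ≤ β) (x : ℝ) {t : ℝ} (ht : 0 < t) :
    psi α β x t ≤ β * Real.exp (α ^ 2 / 4) * Real.exp (-x ^ 2 / (4 * t)) := by
  rw [psi_of_pos ht]
  refine (profile_le_exp hα hβ (le_max_right _ _)).trans ?_
  gcongr ?_ * ?_
  rw [Real.exp_le_exp]
  have h1 : |x| / √t ≤ max (|x| / √t) α := le_max_left _ _
  have h2 : (|x| / √t) ^ 2 ≤ max (|x| / √t) α ^ 2 := by gcongr
  rw [div_pow, sq_abs, Real.sq_sqrt ht.le] at h2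
  have h3 : -x ^ 2 / (4 * t) = -(x ^ 2 / t) / 4 := by field_simp
  rw [h3]
  linarith

lemma psi_eq_of_le {α β x t : ℝ} (ht : 0 < t) (hx : |x| ≤ α * √t) :
    psi α β x t = profile α β α := by
  rw [psi_of_pos ht, max_eq_right]
  rwa [div_le_iff₀ (Real.sqrt_pos.2 ht)]

lemma measurable_psi (α β : ℝ) : Measurable fun q : ℝ × ℝ => psi α β q.1 q.2 := by
  refine Measurable.ite (measurableSet_lt measurable_const measurable_snd) ?_ measurable_const
  refine (continuous_profile α β).measurable.comp
    (g := profile α β) (f := fun q : ℝ × ℝ => max (|q.1| / √q.2) α) ?_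
  fun_prop

lemma IsWeakSolution.p_mem_Icc {α β ustar : ℝ} {u p : ℝ → ℝ → ℝ}
    (hsol : IsWeakSolution α β ustar u p) (x : ℝ) {t : ℝ} (ht : 0 ≤ t) : p x t ∈ Icc (0:ℝ) 1 := by
  obtain ⟨h1, h2, h3⟩ := hsol.2.2.2.1 x t ht
  rcases lt_trichotomy (sSup ((fun s => u x s) '' Icc 0 t)) ustar with h | h | h
  · rw [h1 h]; exact ⟨le_rfl, zero_le_one⟩
  · exact h2 h
  · rw [h3 h]; exact ⟨zero_le_one, le_rfl⟩

lemma IsWeakSolution.exists_isWeakHeat {α β ustar : ℝ} (hα : 0 ≤ α) (hβ : 0 ≤ β)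
    {u p : ℝ → ℝ → ℝ} (hsol : IsWeakSolution α β ustar u p) :
    ∃ v w g : ℝ → ℝ → ℝ, IsWeakHeat v w g ∧
      (∀ x, ∀ t, 0 ≤ t → v x t = u x t - psi α β x t) ∧
      (∀ x, ∀ t, 0 ≤ t → g x t = p x t * u x t) ∧
      ∀ T : ℝ, ∃ C : ℝ, ∀ x, ∀ t ≤ T, |v x t| ≤ C := by
  obtain ⟨w, ⟨hd, hc, hwc, hb⟩, hweak⟩ := hsol.2.2.2.2.2
  have hcont : ∀ F : ℝ → ℝ → ℝ, ContinuousOn (fun q : ℝ × ℝ => F q.1 q.2) (univ ×ˢ Ici 0) →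
      Continuous fun q : ℝ × ℝ => F q.1 (max q.2 0) := fun F hF => by
    exact hF.comp_continuous (f := fun q : ℝ × ℝ => (q.1, max q.2 0)) (by fun_prop)
      fun q => ⟨mem_univ _, mem_Ici.2 (le_max_right _ _)⟩
  set v' : ℝ → ℝ → ℝ := fun x t => u x (max t 0) - psi α β x (max t 0) with hv'
  set w' : ℝ → ℝ → ℝ := fun x t => w x (max t 0) with hw'
  set g' : ℝ → ℝ → ℝ := fun x t => p x (max t 0) * (v' x t + psi α β x (max t 0)) with hg'
  have hvc : Continuous fun q : ℝ × ℝ => v' q.1 q.2 :=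
    hcont (fun x t => u x t - psi α β x t) hc
  have hwc' : Continuous fun q : ℝ × ℝ => w' q.1 q.2 := hcont w hwc
  have hvb : ∀ T : ℝ, ∃ C : ℝ, ∀ x, ∀ t ≤ T, |v' x t| ≤ C := fun T => by
    obtain ⟨C, hC⟩ := hb (max T 0 + 1) (by positivity)
    refine ⟨C, fun x t ht => (hC x (max t 0) ⟨le_max_right _ _, ?_⟩).1⟩
    linarith [max_le_max_right 0 ht]
  have hgm : Measurable fun q : ℝ × ℝ => g' q.1 q.2 := by
    have hm : Measurable fun q : ℝ × ℝ => (q.1, max q.2 0) := by fun_prop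
    exact (hsol.2.2.1.comp hm).mul (hvc.measurable.add ((measurable_psi α β).comp hm))
  have hgb : ∀ T : ℝ, ∃ C : ℝ, ∀ x : ℝ, ∀ t ≤ T, |g' x t| ≤ C := fun T => by
    obtain ⟨C, hC⟩ := hvb T
    refine ⟨C + profile α β α, fun x t ht => ?_⟩
    obtain ⟨h0, h1⟩ := hsol.p_mem_Icc x (le_max_right t 0)
    have h2 : |v' x t + psi α β x (max t 0)| ≤ C + profile α β α := by
      refine (abs_add_le _ _).trans (add_le_add (hC x t ht) ?_)
      rw [abs_of_nonneg (psi_nonneg hα hβ _ _)]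
      exact psi_le hα hβ _ _
    rw [hg', abs_mul, abs_of_nonneg h0]
    exact (mul_le_of_le_one_left (abs_nonneg _) h1).trans h2
  have hvu : ∀ x, ∀ t, 0 ≤ t → v' x t = u x t - psi α β x t := fun x t ht => by
    simp only [hv', max_eq_left ht]
  have hgu : ∀ x, ∀ t, 0 ≤ t → g' x t = p x t * u x t := fun x t ht => by
    simp only [hg', hv', max_eq_left ht, sub_add_cancel]
  have hweak' : ∀ T > (0:ℝ), ∀ φ φt φx : ℝ → ℝ → ℝ, IsTestFun T φ φt φx →
      (∫ t in Ioc (0:ℝ) T, ∫ x : ℝ, φt x t * v' x t)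
        = ∫ t in Ioc (0:ℝ) T, ∫ x : ℝ, (φx x t * w' x t + g' x t * φ x t) := by
    intro T hT φ φt φx hφ
    refine Eq.trans (setIntegral_congr_fun measurableSet_Ioc fun t ht => ?_)
      ((hweak T hT φ φt φx hφ).trans (setIntegral_congr_fun measurableSet_Ioc fun t ht => ?_))
    · simp only [hvu _ t ht.1.le]
    · simp only [hgu _ t ht.1.le, hw', max_eq_left ht.1.le]
  refine ⟨v', w', g', ⟨hvc, hwc', fun x t => hd _ (mem_Ici.2 (le_max_right _ _)) x, hgm, hgb, ?_⟩,
    hvu, hgu, hvb⟩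
  intro φ φ' hφ hφ' R hR hR' T hT
  exact integral_mul_eq_of_weak hvc hwc' hgm hgb hweak' hφ hφ' hR hR' hT

lemma IsWeakHeat.eq_zero {v w g : ℝ → ℝ → ℝ} (h : IsWeakHeat v w g) (x : ℝ) : v x 0 = 0 := by
  have hc : Continuous fun x => v x 0 := h.cont.comp (Continuous.prodMk_left 0)
  have hae : ∀ᵐ x, v x 0 = 0 := by
    refine ae_eq_zero_of_integral_contDiff_smul_eq_zero hc.locallyIntegrable fun φ hφ hφs => ?_
    obtain ⟨R, hR⟩ := hφs.isCompact.isBounded.subset_closedBall 0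
    have hout : ∀ x, R + 1 ≤ |x| → x ∉ tsupport φ := fun x hx hmem => by
      have := hR hmem
      rw [mem_closedBall_zero_iff, Real.norm_eq_abs] at this
      linarith
    have := h.weak φ (deriv φ) (fun x => (hφ.differentiable (by simp) x).hasDerivAt)
      (hφ.continuous_deriv (by simp)) (R + 1) (fun x hx => image_eq_zero_of_notMem_tsupport
        (hout x hx)) (fun x hx => by
        have h1 : x ∉ tsupport (deriv φ) := fun hm => hout x hx (tsupport_deriv_subset hm)
        exact image_eq_zero_of_notMem_tsupport h1) 0 le_rfl
    simpa using this
  exact congrFun (Continuous.ae_eq_iff_eq volume hc continuous_const |>.1 hae) x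

lemma IsWeakHeat.nonpos {v w g : ℝ → ℝ → ℝ} (h : IsWeakHeat v w g)
    (hvb : ∀ T : ℝ, ∃ C : ℝ, ∀ x, ∀ t ≤ T, |v x t| ≤ C)
    (hg : ∀ x, ∀ t, 0 ≤ t → min (v x t) 0 ≤ g x t) (x : ℝ) {t : ℝ} (ht : 0 ≤ t) : v x t ≤ 0 := by
  obtain ⟨C, hC⟩ := hvb t
  have key : ∀ δ > 0, v x t ≤ δ * (x ^ 2 + 2 * t + 1) := by
    intro δ hδ
    set L := |C| / δ + 1 with hL
    have hL1 : 1 ≤ L := le_add_of_nonneg_left (by positivity)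
    have hout : ∀ s ∈ Icc 0 t, ∀ y, L ≤ |y| → v y s ≤ δ * (y ^ 2 + 2 * s + 1) := by
      intro s hs y hy
      have h1 := (abs_le.1 (hC y s hs.2)).2.trans (le_abs_self C)
      have h2 : L ≤ y ^ 2 := by
        rw [← sq_abs]; nlinarith
      have h3 : |C| ≤ δ * L := by
        rw [hL, mul_add, mul_div_cancel₀ _ hδ.ne']; linarith
      nlinarith [hs.1]
    refine h.le_supersolution (V := fun x t => δ * (x ^ 2 + 2 * t + 1)) (Vx := fun x _ => δ * (2 * x))
      (Vxx := fun _ _ => δ * 2) (Vt := fun _ _ => δ * 2) le_rfl (zero_le_one.trans hL1)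
      (fun s _ y => ?_) (fun s _ y => ?_) (fun s _ => continuous_const) (fun y s _ => ?_)
      (by fun_prop) (by fun_prop) (by fun_prop) (fun y => ?_) hout (fun η hη => ?_) t ⟨ht, le_rfl⟩ x
    · have := (((hasDerivAt_pow 2 y).add_const (2 * s)).add_const 1).const_mul δ
      simpa using this
    · simpa using ((hasDerivAt_id y).const_mul 2).const_mul δ
    · simpa using ((((hasDerivAt_id s).const_mul 2).const_add (y ^ 2)).add_const 1).const_mul δ
    · rw [h.eq_zero]; positivity
    · obtain ⟨h₀, hh₀, hu⟩ := exists_uniform_in_time (L := L) (a := 0) (b := t)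
        h.cont.continuousOn hη
      refine ⟨h₀, hh₀, fun a ha b hb hab hh s hs => Eventually.of_forall fun y hy => ?_⟩
      have hyL : |y| ≤ L := by
        by_contra hcon
        exact absurd (hout b hb y (not_le.1 hcon).le) (not_le.2 hy)
      have hs' : s ∈ Icc 0 t := ⟨ha.1.trans hs.1, hs.2.trans hb.2⟩
      have h1 := (abs_le.1 (hu y hyL b hb s hs' (by
        rw [abs_of_nonneg] <;> linarith [hs.1, hs.2]))).2
      have h2 : 0 ≤ δ * (y ^ 2 + 2 * b + 1) := by
        have := hb.1
        positivity
      have h3 : -η ≤ min (v y s) 0 := le_min (by linarith) (by linarith)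
      linarith [hg y s hs'.1]
  refine le_of_forall_pos_le_add fun ε hε => ?_
  have hpos : 0 < x ^ 2 + 2 * t + 1 := by positivity
  have := key (ε / (x ^ 2 + 2 * t + 1)) (by positivity)
  rw [div_mul_cancel₀ _ hpos.ne'] at this
  linarith

lemma hasDerivAt_comp_div_sqrt_left {F F' : ℝ → ℝ} (hF : ∀ y, HasDerivAt F (F' y) y) (x t : ℝ) :
    HasDerivAt (fun x => F (x / √t)) (F' (x / √t) / √t) x := by
  refine ((hF (x / √t)).comp x ((hasDerivAt_id x).div_const (√t))).congr_deriv ?_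
  ring

lemma hasDerivAt_comp_div_sqrt_right {F F' : ℝ → ℝ} (hF : ∀ y, HasDerivAt F (F' y) y) (x : ℝ)
    {t : ℝ} (ht : 0 < t) :
    HasDerivAt (fun t => F (x / √t)) (-(F' (x / √t) * (x / √t) / (2 * t))) t := by
  have hs : √t ≠ 0 := (Real.sqrt_pos.2 ht).ne'
  refine ((hF (x / √t)).comp t
    ((hasDerivAt_const t x).div (Real.hasDerivAt_sqrt ht.ne') hs)).congr_deriv ?_
  have h2 : √t ^ 2 = t := Real.sq_sqrt ht.le
  field_simp
  rw [h2]
  ring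

/-- The heat kernel, up to a constant factor. -/
def heatKernel (x t : ℝ) : ℝ := 1 / √t * Real.exp (-x ^ 2 / (4 * t))

lemma heatKernel_nonneg (x t : ℝ) : 0 ≤ heatKernel x t :=
  mul_nonneg (by positivity) (Real.exp_pos _).le

lemma hasDerivAt_heatKernel_left (x : ℝ) (t : ℝ) :
    HasDerivAt (fun x => heatKernel x t) (-x / (2 * t) * heatKernel x t) x := by
  have h1 : HasDerivAt (fun x : ℝ => -x ^ 2 / (4 * t)) (-(2 * x) / (4 * t)) x := by
    simpa using ((hasDerivAt_pow 2 x).neg.div_const (4 * t))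
  refine (h1.exp.const_mul (1 / √t)).congr_deriv ?_
  have : -(2 * x) / (4 * t) = -x / (2 * t) := by
    rw [show -(2 * x) = 2 * (-x) by ring, show 4 * t = 2 * (2 * t) by ring,
      mul_div_mul_left _ _ two_ne_zero]
  rw [this, heatKernel]
  ring

lemma hasDerivAt_heatKernel_left_left (x t : ℝ) :
    HasDerivAt (fun x => -x / (2 * t) * heatKernel x t)
      ((x ^ 2 / (2 * t) ^ 2 - 1 / (2 * t)) * heatKernel x t) x := by
  have h1 : HasDerivAt (fun x : ℝ => -x / (2 * t)) (-1 / (2 * t)) x :=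
    (hasDerivAt_id x).neg.div_const _
  refine (h1.mul (hasDerivAt_heatKernel_left x t)).congr_deriv ?_
  ring

lemma hasDerivAt_heatKernel_right (x : ℝ) {t : ℝ} (ht : 0 < t) :
    HasDerivAt (fun t => heatKernel x t)
      ((x ^ 2 / (2 * t) ^ 2 - 1 / (2 * t)) * heatKernel x t) t := by
  have hs : √t ≠ 0 := (Real.sqrt_pos.2 ht).ne'
  have h1 := (hasDerivAt_const t (-x ^ 2)).div ((hasDerivAt_id t).const_mul 4)
    (by simpa using ht.ne')
  have h2 := (hasDerivAt_const t (1:ℝ)).div (Real.hasDerivAt_sqrt ht.ne') hs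
  refine (h2.mul h1.exp).congr_deriv ?_
  have h3 : √t ^ 2 = t := Real.sq_sqrt ht.le
  simp only [heatKernel, id, Pi.div_apply]
  set e := Real.exp (-x ^ 2 / (4 * t))
  field_simp
  rw [h3]
  ring

lemma IsWeakHeat.le_barrier {v w g : ℝ → ℝ → ℝ} (h : IsWeakHeat v w g) {α β ε M Y T : ℝ}
    (hα : 0 < α) (hβ : 0 < β) (hε : 0 < ε) (hM : 0 ≤ M) (hY : 0 < Y) (hT : 0 < T)
    (hv : ∀ x t, 0 ≤ t → v x t ≤ 0)
    (hg : ∀ x t, 0 ≤ t → min (v x t + psi α β x t) 0 ≤ g x t)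
    (hgY : ∀ᵐ x, Y < x → ∀ t, x ^ 2 / α ^ 2 < t → g x t = v x t + psi α β x t)
    (hMε : ∀ y, 0 ≤ y → (α * β / 2) * Real.exp (α ^ 2 / 4) * y ≤ ε / 2 + M * y ^ 3)
    (hTM : 12 * M * α ≤ ε * T)
    (hTK : ∀ t, T ≤ t → profile α β α * Real.exp (Y - α * √t) ≤ 1 / t ^ 2)
    {t : ℝ} (ht : T ≤ t) (x : ℝ) :
    v x t ≤ ε - profile α β (x / √t) + M * max (α - x / √t) 0 ^ 3
      + profile α β α * Real.exp (Y - x) + (1 / T - 1 / t)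
      + β * Real.exp (α ^ 2 / 4) * √T * heatKernel x t := by
  obtain ⟨T₁, hT₁⟩ : ∃ T₁, T₁ = t := ⟨t, rfl⟩
  set K := profile α β α with hK
  have hK0 : 0 ≤ K := profile_nonneg hα.le hβ.le α
  set c := (α * β / 2) * Real.exp (α ^ 2 / 4) with hc
  set C₁ := β * Real.exp (α ^ 2 / 4) with hC₁
  have hC₁0 : 0 < C₁ := by positivity
  set A := C₁ * √T with hA
  have hA0 : 0 ≤ A := by positivity
  set F : ℝ → ℝ := fun y => ε - profile α β y + M * max (α - y) 0 ^ 3 with hF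
  set F' : ℝ → ℝ := fun y => c * Real.exp (-y ^ 2 / 4) - 3 * M * max (α - y) 0 ^ 2 with hF'
  set F'' : ℝ → ℝ := fun y => -(c * (y / 2) * Real.exp (-y ^ 2 / 4)) + 6 * M * max (α - y) 0
    with hF''
  have hFd : ∀ y, HasDerivAt F (F' y) y := fun y => by
    have h1 := ((hasDerivAt_max_zero_pow 1 (α - y)).comp y
      ((hasDerivAt_id y).const_sub α)).const_mul M
    refine (((hasDerivAt_profile α β y).const_sub ε).add h1).congr_deriv ?_
    simp only [hF', hc]
    push_cast
    ring
  have hFd' : ∀ y, HasDerivAt F' (F'' y) y := fun y => by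
    have h1 := ((hasDerivAt_max_zero_pow 0 (α - y)).comp y
      ((hasDerivAt_id y).const_sub α)).const_mul (3 * M)
    have h2 : HasDerivAt (fun y : ℝ => -y ^ 2 / 4) (-(2 * y) / 4) y := by
      simpa using ((hasDerivAt_pow 2 y).neg.div_const 4)
    refine ((h2.exp.const_mul c).sub h1).congr_deriv ?_
    simp only [hF'']
    push_cast
    ring
  have hFc : Continuous F := continuous_iff_continuousAt.2 fun y => (hFd y).continuousAt
  have hFc' : Continuous F' := continuous_iff_continuousAt.2 fun y => (hFd' y).continuousAt
  have hFc'' : Continuous F'' := by fun_prop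
  have hFpos : ∀ y, ε / 2 ≤ F y + profile α β (max y α) := fun y => by
    rcases le_total α y with hy | hy
    · simp only [hF, max_eq_left hy, max_eq_right (sub_nonpos.2 hy)]
      linarith
    · have h1 := profile_sub_le hα.le hβ.le (sub_nonneg.2 hy)
      have h2 := hMε (α - y) (sub_nonneg.2 hy)
      rw [sub_sub_cancel] at h1
      change profile α β y - K ≤ c * (α - y) at h1
      simp only [hF, max_eq_right hy, max_eq_left (sub_nonneg.2 hy), ← hK]
      linarith
  set V : ℝ → ℝ → ℝ := fun x t => F (x / √t) + K * Real.exp (Y - x) + (1 / T - 1 / t)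
    + A * heatKernel x t with hV
  set Vx : ℝ → ℝ → ℝ := fun x t => F' (x / √t) / √t + -(K * Real.exp (Y - x))
    + A * (-x / (2 * t) * heatKernel x t) with hVx
  set Vxx : ℝ → ℝ → ℝ := fun x t => F'' (x / √t) / √t / √t + K * Real.exp (Y - x)
    + A * ((x ^ 2 / (2 * t) ^ 2 - 1 / (2 * t)) * heatKernel x t) with hVxx
  set Vt : ℝ → ℝ → ℝ := fun x t => -(F' (x / √t) * (x / √t) / (2 * t)) + 1 / t ^ 2
    + A * ((x ^ 2 / (2 * t) ^ 2 - 1 / (2 * t)) * heatKernel x t) with hVt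
  have hcont : ∀ G : ℝ × ℝ → ℝ, (∀ q : ℝ × ℝ, q.2 ≠ 0 → √q.2 ≠ 0 → ContinuousAt G q) →
      ContinuousOn G (univ ×ˢ Icc T T₁) := fun G hG q hq =>
    (hG q (hT.trans_le hq.2.1).ne'
      (Real.sqrt_pos.2 (hT.trans_le hq.2.1)).ne').continuousWithinAt
  have hcaloric : ∀ x t, 0 < t → Vxx x t - Vt x t = (6 * M * max (α - x / √t) 0
      - 3 / 2 * M * (x / √t) * max (α - x / √t) 0 ^ 2) / t + K * Real.exp (Y - x)
      - 1 / t ^ 2 := fun x t ht => by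
    simp only [hVxx, hVt, hF', hF'']
    rw [div_div, Real.mul_self_sqrt ht.le]
    set y := x / √t
    set e := Real.exp (-y ^ 2 / 4)
    field_simp
    ring
  have hVψ : ∀ x t, T ≤ t → F (x / √t) + K * Real.exp (Y - x) + A * heatKernel x t ≤ V x t :=
    fun x t ht => by
      have := one_div_le_one_div_of_le hT ht
      simp only [hV]
      linarith
  have hVY : ∀ x t, T ≤ t → x ≤ Y → 0 ≤ V x t := fun x t ht hx => by
    have h1 := hVψ x t ht
    have h2 := hFpos (x / √t)
    have h3 : profile α β (max (x / √t) α) ≤ K := antitone_profile hα.le hβ.le (le_max_right _ _)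
    have h4 : K ≤ K * Real.exp (Y - x) :=
      le_mul_of_one_le_right hK0 (Real.one_le_exp (sub_nonneg.2 hx))
    have h5 := mul_nonneg hA0 (heatKernel_nonneg x t)
    linarith
  have hVpsi : ∀ x t, T ≤ t → 0 ≤ x →
      ε / 2 + K * Real.exp (Y - x) + A * heatKernel x t ≤ V x t + psi α β x t :=
    fun x t ht hx => by
      have h1 := hVψ x t ht
      have h2 := hFpos (x / √t)
      rw [psi_of_pos (hT.trans_le ht), abs_of_nonneg hx]
      linarith
  set L := 8 * C₁ * T₁ / ε + 1 with hL
  have hTT : 0 < T₁ := by rw [hT₁]; exact hT.trans_le ht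
  have hL1 : 1 ≤ L := le_add_of_nonneg_left (by positivity)
  have hVL : ∀ t ∈ Icc T T₁, ∀ x, L ≤ |x| → 0 ≤ V x t := fun t ht x hx => by
    rcases le_total x Y with hxY | hxY
    · exact hVY x t ht.1 hxY
    have hx0 : 0 ≤ x := hY.le.trans hxY
    rw [abs_of_nonneg hx0] at hx
    have ht0 := hT.trans_le ht.1
    have h1 := hVpsi x t ht.1 hx0
    have h2 := psi_le_exp hα hβ.le x ht0
    have h3 : C₁ * Real.exp (-x ^ 2 / (4 * t)) ≤ ε / 2 := by
      have hz : 2 * C₁ / ε ≤ x ^ 2 / (4 * t) := by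
        rw [div_le_div_iff₀ hε (by positivity)]
        have h4 : 8 * C₁ * T₁ ≤ L * ε := by
          rw [hL, add_mul, div_mul_cancel₀ _ hε.ne']; linarith
        have h5 : L ≤ x ^ 2 := by nlinarith
        have h6 := mul_le_mul_of_nonneg_right h5 hε.le
        have h7 := mul_le_mul_of_nonneg_left ht.2 hC₁0.le
        linarith
      have h4 := hz.trans ((lt_add_one _).le.trans (Real.add_one_le_exp _))
      rw [neg_div, Real.exp_neg, ← div_eq_mul_inv, div_le_iff₀ (Real.exp_pos _)]
      rw [div_le_iff₀ hε] at h4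
      linarith
    have h5 := mul_nonneg hK0 (Real.exp_pos (Y - x)).le
    have h6 := mul_nonneg hA0 (heatKernel_nonneg x t)
    linarith
  have hVc : ContinuousOn (fun q : ℝ × ℝ => V q.1 q.2) (univ ×ˢ Icc T T₁) :=
    hcont _ fun q hq hq' => by
      have : 4 * q.2 ≠ 0 := by positivity
      simp only [hV, heatKernel]
      fun_prop (disch := assumption)
  refine h.le_supersolution (V := V) (Vx := Vx) (Vxx := Vxx) (Vt := Vt) (L := L)
    hT.le (zero_le_one.trans hL1) (fun t ht x => ?_) (fun t ht x => ?_) (fun t ht => ?_)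
    (fun x t ht => ?_) hVc (hcont _ fun q hq hq' => ?_) (hcont _ fun q hq hq' => ?_)
    (fun x => (hv x T hT.le).trans ?_)
    (fun t ht x hx => (hv x t (hT.le.trans ht.1)).trans (hVL t ht x hx)) (fun η hη => ?_)
    t ⟨ht, hT₁.ge⟩ x
  · have h1 : HasDerivAt (fun x => K * Real.exp (Y - x)) (-(K * Real.exp (Y - x))) x := by
      simpa using (((hasDerivAt_id x).const_sub Y).exp.const_mul K)
    exact (((hasDerivAt_comp_div_sqrt_left hFd x t).add h1).add_const _).add
      ((hasDerivAt_heatKernel_left x t).const_mul A)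
  · have h1 : HasDerivAt (fun x => -(K * Real.exp (Y - x))) (K * Real.exp (Y - x)) x := by
      refine (((hasDerivAt_id x).const_sub Y).exp.const_mul K).neg.congr_deriv ?_
      simp
    exact (((hasDerivAt_comp_div_sqrt_left hFd' x t).div_const _).add h1).add
      ((hasDerivAt_heatKernel_left_left x t).const_mul A)
  · simp only [hVxx, heatKernel]
    fun_prop
  · have ht0 := hT.trans_le ht.1
    have h1 : HasDerivAt (fun t : ℝ => 1 / T - 1 / t) (1 / t ^ 2) t := by
      simpa using (hasDerivAt_inv ht0.ne').const_sub (1 / T)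
    exact (((hasDerivAt_comp_div_sqrt_right hFd x ht0).add_const _).add h1).add
      ((hasDerivAt_heatKernel_right x ht0).const_mul A)
  · have : 4 * q.2 ≠ 0 := by positivity
    have : 2 * q.2 ≠ 0 := by positivity
    simp only [hVx, heatKernel]
    fun_prop (disch := assumption)
  · have : 4 * q.2 ≠ 0 := by positivity
    have : 2 * q.2 ≠ 0 := by positivity
    have : (2 * q.2) ^ 2 ≠ 0 := by positivity
    have : q.2 ^ 2 ≠ 0 := by positivity
    simp only [hVt, heatKernel]
    fun_prop (disch := assumption)
  · rcases le_total x Y with hxY | hxY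
    · exact hVY x T le_rfl hxY
    have h1 := hVpsi x T le_rfl (hY.le.trans hxY)
    have h2 := psi_le_exp hα hβ.le x hT
    have h3 : A * heatKernel x T = C₁ * Real.exp (-x ^ 2 / (4 * T)) := by
      have := (Real.sqrt_pos.2 hT).ne'
      rw [hA, heatKernel]
      field_simp
    have h5 := mul_nonneg hK0 (Real.exp_pos (Y - x)).le
    linarith
  · obtain ⟨h₁, hh₁, hu₁⟩ := exists_uniform_in_time (L := L) (a := T) (b := T₁)
      h.cont.continuousOn (half_pos hη)
    obtain ⟨h₂, hh₂, hu₂⟩ := exists_uniform_in_time (L := L) hVc (half_pos hη)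
    refine ⟨min h₁ h₂, by positivity, fun a ha b hb hab hh s hs => ?_⟩
    rw [le_min_iff] at hh
    filter_upwards [hgY] with x hx hlt
    have hs' : s ∈ Icc T T₁ := ⟨ha.1.trans hs.1, hs.2.trans hb.2⟩
    have hvb := hv x b (hT.le.trans hb.1)
    have hxL : |x| ≤ L := by
      by_contra hcon
      exact absurd (hVL b hb x (not_le.1 hcon).le) (not_le.2 (hlt.trans_le hvb))
    have hxY : Y < x := by
      by_contra hcon
      exact absurd (hVY x b hb.1 (not_lt.1 hcon)) (not_le.2 (hlt.trans_le hvb))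
    have hx0 : 0 < x := hY.trans hxY
    have ha0 := hT.trans_le ha.1
    have hs0 := hT.trans_le hs'.1
    have hsa := Real.sqrt_pos.2 ha0
    have h1 := (abs_le.1 (hu₁ x hxL b hb s hs' (by
      rw [abs_of_nonneg] <;> linarith [hs.1, hs.2]))).2
    have h5 := mul_nonneg hK0 (Real.exp_pos (Y - x)).le
    rw [hcaloric x a ha0]
    rcases lt_or_ge x (α * √a) with hxa | hxa
    · have h2 := (abs_le.1 (hu₂ x hxL b hb a ha (by
        rw [abs_of_nonneg] <;> linarith))).1
      have hxs : x ^ 2 / α ^ 2 < s := by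
        rw [div_lt_iff₀ (by positivity)]
        calc x ^ 2 < (α * √a) ^ 2 := by gcongr
          _ = a * α ^ 2 := by rw [mul_pow, Real.sq_sqrt ha0.le, mul_comm]
          _ ≤ s * α ^ 2 := by gcongr; exact hs.1
      have hps : psi α β x s = K := psi_eq_of_le hs0 (by
        rw [abs_of_nonneg hx0.le]
        exact hxa.le.trans (by gcongr; exact hs.1))
      have hpa : psi α β x a = K := psi_eq_of_le ha0 (by
        rw [abs_of_nonneg hx0.le]; exact hxa.le)
      have h3 := hVpsi x a ha.1 hx0.le
      have h6 := mul_nonneg hA0 (heatKernel_nonneg x a)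
      rw [hx hxY s hxs, hps]
      rw [hpa] at h3
      have hy0 : 0 ≤ x / √a := by positivity
      have hyα : max (α - x / √a) 0 ≤ α := max_le (by linarith) hα.le
      have h7 : (6 * M * max (α - x / √a) 0 - 3 / 2 * M * (x / √a) * max (α - x / √a) 0 ^ 2) / a
          ≤ ε / 2 := by
        rw [div_le_iff₀ ha0]
        have h8 : 0 ≤ 3 / 2 * M * (x / √a) * max (α - x / √a) 0 ^ 2 := by positivity
        have h9 := mul_le_mul_of_nonneg_left hyα hM
        have h10 := mul_le_mul_of_nonneg_left ha.1 hε.le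
        linarith
      have h8 : 0 ≤ 1 / a ^ 2 := by positivity
      linarith
    · have h2 := (abs_le.1 (hu₂ x hxL b hb s hs' (by
        rw [abs_of_nonneg] <;> linarith [hs.1, hs.2]))).1
      have h3 := hVpsi x s hs'.1 hx0.le
      have h6 := mul_nonneg hA0 (heatKernel_nonneg x s)
      have hy : max (α - x / √a) 0 = 0 := max_eq_right (by
        rw [sub_nonpos, le_div_iff₀ hsa]; exact hxa)
      have h7 : K * Real.exp (Y - x) ≤ 1 / a ^ 2 := by
        refine le_trans ?_ (hTK a ha.1)
        gcongr
      have h8 : -η ≤ min (v x s + psi α β x s) 0 := le_min (by linarith) (by linarith)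
      have h9 := hg x s hs0.le
      rw [hy]
      simp only [mul_zero, ne_eq, OfNat.ofNat_ne_zero, not_false_eq_true, zero_pow, sub_zero,
        zero_div, zero_add]
      linarith

lemma heatKernel_le {x t : ℝ} (hx : 0 < x) (ht : 0 < t) : heatKernel x t ≤ 1 / x := by
  have hs := Real.sqrt_pos.2 ht
  have h1 : x / √t ≤ Real.exp (x ^ 2 / (4 * t)) := by
    refine le_trans ?_ (Real.add_one_le_exp _)
    have h2 : x ^ 2 / (4 * t) = (x / √t) ^ 2 / 4 := by
      rw [div_pow, Real.sq_sqrt ht.le, div_div, mul_comm]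
    rw [h2]
    nlinarith [sq_nonneg (x / √t / 2 - 1)]
  rw [heatKernel, neg_div, Real.exp_neg, ← div_eq_mul_inv, div_div,
    one_div_le_one_div (mul_pos hs (Real.exp_pos _)) hx]
  rwa [div_le_iff₀' hs] at h1

lemma exists_cubic_bound {c ε : ℝ} (hc : 0 < c) (hε : 0 < ε) :
    ∃ M, 0 ≤ M ∧ ∀ y, 0 ≤ y → c * y ≤ ε + M * y ^ 3 := by
  refine ⟨c / (ε / c) ^ 2, by positivity, fun y hy => ?_⟩
  rcases le_total y (ε / c) with h | h
  · have h1 : c * y ≤ ε := by rwa [le_div_iff₀' hc] at h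
    have h2 : 0 ≤ c / (ε / c) ^ 2 * y ^ 3 := by positivity
    linarith
  · have h1 : c * y ≤ c / (ε / c) ^ 2 * y ^ 3 := by
      rw [div_mul_eq_mul_div, le_div_iff₀ (by positivity)]
      have h2 : (ε / c) ^ 2 ≤ y ^ 2 := by gcongr
      calc c * y * (ε / c) ^ 2 ≤ c * y * y ^ 2 := by gcongr
        _ = c * y ^ 3 := by ring
    linarith

lemma eventually_exp_sqrt_le {α : ℝ} (hα : 0 < α) {K : ℝ} (hK : 0 ≤ K) (Y : ℝ) :
    ∀ᶠ t in atTop, K * Real.exp (Y - α * √t) ≤ 1 / t ^ 2 := by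
  have h1 : Tendsto (fun t => α * √t) atTop atTop :=
    Real.tendsto_sqrt_atTop.const_mul_atTop hα
  have h2 := (Real.tendsto_pow_mul_exp_neg_atTop_nhds_zero 4).comp h1
  have h3 : 0 < α ^ 4 / (K * Real.exp Y + 1) := by positivity
  filter_upwards [h2.eventually_lt_const h3, eventually_gt_atTop 0] with t ht ht0
  simp only [Function.comp] at ht
  have h4 : (α * √t) ^ 4 = α ^ 4 * t ^ 2 := by
    rw [mul_pow, show √t ^ 4 = (√t ^ 2) ^ 2 by ring, Real.sq_sqrt ht0.le]
  rw [h4, lt_div_iff₀ (by positivity)] at ht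
  have hα4 : 0 < α ^ 4 := by positivity
  rw [le_div_iff₀ (by positivity), sub_eq_add_neg, Real.exp_add]
  have h5 : t ^ 2 * Real.exp (-(α * √t)) * (K * Real.exp Y + 1) ≤ 1 := by
    refine le_of_mul_le_mul_left ?_ hα4
    linarith
  have h6 : 0 ≤ t ^ 2 * Real.exp (-(α * √t)) := by positivity
  linarith

/-- Beyond the parabola `t = x² / α²`, full precipitation cannot persist forever. -/
lemma IsWeakSolution.not_ae_eq_one {α β ustar : ℝ} (hα : 0 < α) (hβ : 0 < β) (hu : 0 < ustar)
    {u p : ℝ → ℝ → ℝ} (hsol : IsWeakSolution α β ustar u p) {Y : ℝ} (hY : 0 < Y) :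
    ¬ ∀ᵐ x, Y < x → ∀ t, x ^ 2 / α ^ 2 < t → p x t = 1 := by
  intro H
  obtain ⟨v, w, g, hvwg, hvu, hgu, hvb⟩ := hsol.exists_isWeakHeat hα.le hβ.le
  have huv : ∀ x t, 0 ≤ t → u x t = v x t + psi α β x t := fun x t ht => by
    rw [hvu x t ht]; ring
  have hg : ∀ x t, 0 ≤ t → min (v x t + psi α β x t) 0 ≤ g x t := fun x t ht => by
    rw [hgu x t ht, ← huv x t ht]
    obtain ⟨h0, h1⟩ := hsol.p_mem_Icc x ht
    rcases le_total 0 (u x t) with h | h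
    · rw [min_eq_right h]; positivity
    · rw [min_eq_left h]; nlinarith
  have hv : ∀ x t, 0 ≤ t → v x t ≤ 0 := fun x t ht => hvwg.nonpos hvb (fun x t ht =>
    (min_le_min_right 0 (le_add_of_nonneg_right (psi_nonneg hα.le hβ.le x t))).trans
      (hg x t ht)) x ht
  have hgY : ∀ᵐ x, Y < x → ∀ t, x ^ 2 / α ^ 2 < t → g x t = v x t + psi α β x t := by
    filter_upwards [H] with x hx hxY t ht
    have ht0 : 0 ≤ t := le_trans (by positivity) ht.le
    rw [hgu x t ht0, hx hxY t ht, one_mul, huv x t ht0]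
  set K := profile α β α with hK
  have hK0 : 0 ≤ K := profile_nonneg hα.le hβ.le α
  set C₁ := β * Real.exp (α ^ 2 / 4) with hC₁
  have hC₁0 : 0 < C₁ := by positivity
  have hε : 0 < ustar / 4 := by positivity
  obtain ⟨M, hM, hMε⟩ := exists_cubic_bound (c := (α * β / 2) * Real.exp (α ^ 2 / 4))
    (by positivity) (half_pos hε)
  obtain ⟨T₂, hT₂⟩ := eventually_atTop.1 (eventually_exp_sqrt_le hα hK0 Y)
  obtain ⟨T, hT, hTM, hTu, hTT⟩ : ∃ T, 0 < T ∧ 12 * M * α ≤ ustar / 4 * T ∧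
      1 / T ≤ ustar / 4 ∧ T₂ ≤ T := by
    have h0 : 0 < ustar / 4 := hε
    have h1 : ∀ᶠ T in atTop, 12 * M * α / (ustar / 4) ≤ T := eventually_ge_atTop _
    have h2 : ∀ᶠ T in atTop, 1 / (ustar / 4) ≤ T := eventually_ge_atTop _
    obtain ⟨T, h1, h2, h3, h4⟩ :=
      (h1.and (h2.and ((eventually_ge_atTop T₂).and (eventually_gt_atTop 0)))).exists
    refine ⟨T, h4, by rwa [div_le_iff₀' h0] at h1, ?_, h3⟩
    rwa [one_div_le h4 h0]
  have hbar := fun (t : ℝ) (ht : T ≤ t) (x : ℝ) => hvwg.le_barrier hα hβ hε hM hY hT hv hg hgY hMε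
    hTM (fun t ht => hT₂ t (hTT.trans ht)) ht x
  set A := C₁ * √T with hA
  have hA0 : 0 ≤ A := by positivity
  have hubound : ∀ x, 0 < x → ∀ s, 0 ≤ s → s ≤ x ^ 2 / α ^ 2 →
      u x s ≤ ustar / 2 + (K * Real.exp (Y - x) + A * (1 / x)) := by
    intro x hx s hs hsx
    have hK1 : 0 ≤ K * Real.exp (Y - x) := by positivity
    rcases lt_or_ge s T with hsT | hsT
    · have h1 : psi α β x s ≤ A * (1 / x) := by
        rcases hs.eq_or_lt with rfl | hs0
        · rw [psi_of_nonpos le_rfl]; positivity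
        · refine (psi_le_exp hα hβ.le x hs0).trans ?_
          have h2 : Real.exp (-x ^ 2 / (4 * s)) = √s * heatKernel x s := by
            have := (Real.sqrt_pos.2 hs0).ne'
            rw [heatKernel]
            field_simp
          rw [h2]
          calc C₁ * (√s * heatKernel x s) ≤ C₁ * (√T * (1 / x)) := by
                gcongr
                · exact heatKernel_nonneg x s
                · exact heatKernel_le hx hs0
            _ = A * (1 / x) := (mul_assoc _ _ _).symm
      have := hv x s hs
      rw [huv x s hs]
      linarith
    · have hs0 := hT.trans_le hsT
      have hsq := Real.sqrt_pos.2 hs0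
      have hαs : α ≤ x / √s := by
        rw [le_div_iff₀ hsq]
        rw [le_div_iff₀ (by positivity)] at hsx
        refine le_of_sq_le_sq ?_ hx.le
        rw [mul_pow, Real.sq_sqrt hs]
        linarith
      have h1 := hbar s hsT x
      rw [max_eq_right (sub_nonpos.2 hαs)] at h1
      have h2 : psi α β x s = profile α β (x / √s) := by
        rw [psi_of_pos hs0, abs_of_pos hx, max_eq_left hαs]
      have h3 := mul_le_mul_of_nonneg_left (heatKernel_le hx hs0) hA0
      have h4 : 0 ≤ 1 / s := by positivity
      rw [huv x s hs, h2]
      linarith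
  have hev : ∀ᶠ x in atTop, K * Real.exp (Y - x) + A * (1 / x) < ustar / 4 := by
    refine Tendsto.eventually_lt_const hε ?_
    have h1 : Tendsto (fun x : ℝ => K * Real.exp (Y - x)) atTop (nhds (K * 0)) :=
      (Real.tendsto_exp_atBot.comp (tendsto_atBot_add_const_left atTop Y
        tendsto_neg_atTop_atBot)).const_mul K
    have h2 : Tendsto (fun x : ℝ => A * (1 / x)) atTop (nhds (A * 0)) :=
      (tendsto_const_nhds.div_atTop tendsto_id).const_mul A
    simpa using h1.add h2
  obtain ⟨X, hX⟩ := eventually_atTop.1 hev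
  obtain ⟨x, hx, hxX⟩ := (Measure.dense_of_ae H).exists_gt (max X Y)
  have hxY : Y < x := (le_max_right _ _).trans_lt hxX
  have hx0 : 0 < x := hY.trans hxY
  have hsmall := hX x ((le_max_left _ _).trans hxX.le)
  set t₀ := x ^ 2 / α ^ 2 with ht₀
  have ht₀0 : 0 < t₀ := by positivity
  have hpsi : ∀ t, t₀ ≤ t → psi α β x t = K := fun t ht => by
    refine psi_eq_of_le (ht₀0.trans_le ht) ?_
    rw [abs_of_pos hx0]
    rw [ht₀, div_le_iff₀ (by positivity)] at ht
    refine le_of_sq_le_sq ?_ (by positivity)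
    rw [mul_pow, Real.sq_sqrt (by nlinarith [sq_pos_of_pos hα, sq_nonneg x])]
    linarith
  have hvc : Continuous fun t => v x t := hvwg.cont.comp (Continuous.prodMk_right x)
  obtain ⟨δ, hδ, hclose⟩ := Metric.continuousAt_iff.1 (hvc.continuousAt (x := t₀)) (ustar / 8)
    (by positivity)
  set t := t₀ + δ / 2 with ht
  have hbound : ∀ s ∈ Icc 0 t, u x s ≤ 7 * ustar / 8 := by
    intro s hs
    have h1 := hubound x hx0 t₀ ht₀0.le le_rfl
    rcases le_total s t₀ with hst | hst
    · linarith [hubound x hx0 s hs.1 hst]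
    · have h2 := hclose (x := s) (by
        rw [Real.dist_eq, abs_of_nonneg] <;> linarith [hs.2])
      rw [Real.dist_eq] at h2
      have h3 := (abs_lt.1 h2).2
      rw [huv x t₀ ht₀0.le, hpsi t₀ le_rfl] at h1
      rw [huv x s hs.1, hpsi s hst]
      linarith
  have ht0 : 0 ≤ t := by positivity
  have hsup : sSup ((fun s => u x s) '' Icc 0 t) < ustar := by
    refine lt_of_le_of_lt (b := 7 * ustar / 8) (csSup_le ((nonempty_Icc.2 ht0).image _) ?_)
      (by linarith)
    rintro _ ⟨s, hs, rfl⟩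
    exact hbound s hs
  have h0 := (hsol.2.2.2.1 x t ht0).1 hsup
  have h1 := hx hxY t (by linarith)
  rw [h0] at h1
  exact zero_ne_one h1

/-- no precipitation ring of infinite width:
`liminf_{x→∞} u(x, x²/α²) ≤ u*` and for every `Y > 0` the essential infimum of `p` over
`{(x,t) : x ≥ Y, t ≥ x²/α²}` is strictly less than `1`. -/
theorem no_ring_of_infinite_width (α β ustar : ℝ) (hα : 0 < α) (hβ : 0 < β)
    (hu : 0 < ustar)
    (u p : ℝ → ℝ → ℝ) (hsol : IsWeakSolution α β ustar u p) :
    Filter.liminf (fun x : ℝ => u x (x ^ 2 / α ^ 2)) Filter.atTop ≤ ustar ∧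
    ∀ Y : ℝ, 0 < Y →
      essInf (fun q : ℝ × ℝ => p q.1 q.2)
        ((volume : Measure (ℝ × ℝ)).restrict
          {q : ℝ × ℝ | Y ≤ q.1 ∧ q.1 ^ 2 / α ^ 2 ≤ q.2}) < 1 := by
  refine ⟨?_, fun Y hY => ?_⟩
  · rw [Filter.liminf_eq]
    refine Real.sSup_le (fun a ha => ?_) hu.le
    by_contra! hlt
    obtain ⟨X, hX⟩ := eventually_atTop.1 (show ∀ᶠ x in atTop, a ≤ u x (x ^ 2 / α ^ 2) from ha)
    refine hsol.not_ae_eq_one hα hβ hu (Y := max X 1) (by positivity)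
      (Eventually.of_forall fun x hx t ht => ?_)
    have ht₀ : 0 ≤ x ^ 2 / α ^ 2 := by positivity
    have ht0 : 0 ≤ t := ht₀.trans ht.le
    refine (hsol.2.2.2.1 x t ht0).2.2 ((hlt.trans_le (hX x ((le_max_left _ _).trans hx.le))).trans_le
      (le_csSup ?_ ⟨_, ⟨ht₀, ht.le⟩, rfl⟩))
    obtain ⟨v, -, -, -, hvu, -, hvb⟩ := hsol.exists_isWeakHeat hα.le hβ.le
    obtain ⟨C, hC⟩ := hvb t
    refine ⟨C + profile α β α, ?_⟩
    rintro _ ⟨s, hs, rfl⟩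
    have h1 := (abs_le.1 (hC x s hs.2)).2
    rw [hvu x s hs.1] at h1
    have h2 := psi_le hα.le hβ.le x s
    simp only
    linarith
  · by_contra! hge
    rw [essInf, Filter.liminf_eq] at hge
    set S := {a : ℝ | ∀ᵐ q ∂((volume : Measure (ℝ × ℝ)).restrict
      {q : ℝ × ℝ | Y ≤ q.1 ∧ q.1 ^ 2 / α ^ 2 ≤ q.2}), a ≤ p q.1 q.2} with hS
    have hne : S.Nonempty := by
      by_contra hcon
      rw [not_nonempty_iff_eq_empty.1 hcon, Real.sSup_empty] at hge
      linarith
    have hae : ∀ n : ℕ, ∀ᵐ q ∂((volume : Measure (ℝ × ℝ)).restrict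
        {q : ℝ × ℝ | Y ≤ q.1 ∧ q.1 ^ 2 / α ^ 2 ≤ q.2}), 1 - 1 / ((n : ℝ) + 1) ≤ p q.1 q.2 := by
      intro n
      have hn : (0:ℝ) < 1 / ((n : ℝ) + 1) := by positivity
      obtain ⟨b, hb, hlt⟩ := exists_lt_of_lt_csSup hne
        (show 1 - 1 / ((n : ℝ) + 1) < sSup S by linarith)
      filter_upwards [show ∀ᵐ q ∂_, b ≤ p q.1 q.2 from hb] with q hq
      exact hlt.le.trans hq
    have hmeas : MeasurableSet {q : ℝ × ℝ | Y ≤ q.1 ∧ q.1 ^ 2 / α ^ 2 ≤ q.2} :=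
      (measurableSet_le measurable_const measurable_fst).inter
        (measurableSet_le (by fun_prop) measurable_snd)
    rw [← ae_all_iff, ae_restrict_iff' hmeas, Measure.volume_eq_prod] at hae
    refine hsol.not_ae_eq_one hα hβ hu hY ?_
    filter_upwards [Measure.ae_ae_of_ae_prod hae] with x hx hxY t ht
    obtain ⟨s, hs, hs1, hs2⟩ := (Measure.dense_of_ae hx).exists_between ht
    have hs0 : 0 ≤ s := le_trans (by positivity) hs1.le
    have h1 : 1 ≤ p x s := le_of_tendsto'
      (by simpa using tendsto_one_div_add_atTop_nhds_zero_nat.const_sub (1:ℝ))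
      (hs ⟨hxY.le, hs1.le⟩)
    have ht0 : 0 ≤ t := hs0.trans hs2.le
    exact le_antisymm (hsol.p_mem_Icc x ht0).2
      (h1.trans (hsol.2.2.2.2.1 x (mem_Ici.2 hs0) (mem_Ici.2 ht0) hs2.le))

end
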